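/- arXiv:2507.14973 — 11 statements merged into one kernel-verified Lean document; each statement's English description precedes it below -/
import Mathlib

section
/- Assume the principle (*): there is no tree π-base for ω* of height less than 𝔠, and every tree π-base for ω* of height 𝔠 has a cofinal branch. Then for every sequentially compact topological space X of cardinality at most 𝔠 there exists a nonprincipal ultrafilter p on ℕ such that X is p-compact. -/
/-- `y` is a `p`-limit of the sequence `x`: every open neighbourhood of `y`
contains `x n` for a `p`-large set of `n`. -/
def IsPLimit {X : Type*} [TopologicalSpace X] (p : Ultrafilter ℕ) (x : ℕ → X) (y : X) : Prop :=
  ∀ U : Set X, IsOpen U → y ∈ U → {n | x n ∈ U} ∈ p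

/-- `X` is `p`-compact: every sequence in `X` has a `p`-limit. -/
def PCompact (X : Type*) [TopologicalSpace X] (p : Ultrafilter ℕ) : Prop :=
  ∀ x : ℕ → X, ∃ y : X, IsPLimit p x y

/-- An ultrafilter on `ℕ` is nonprincipal if it contains no finite set. -/
def Nonprincipal (p : Ultrafilter ℕ) : Prop :=
  ∀ A : Set ℕ, A.Finite → A ∉ p

/-- `a ⊆* b`: `a \ b` is finite. -/
def AlmostSubset (a b : Set ℕ) : Prop := (a \ b).Finite

/-- `f : ℕ → ℕ` is finite-to-one: every fiber is finite. -/
def FiniteToOne (f : ℕ → ℕ) : Prop := ∀ n : ℕ, (f ⁻¹' {n}).Finite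

/-- A topological space is countably compact if every countable open cover
has a finite subcover. -/
def CountablyCompact (X : Type*) [TopologicalSpace X] : Prop :=
  ∀ 𝒰 : Set (Set X), 𝒰.Countable → (∀ U ∈ 𝒰, IsOpen U) → ⋃₀ 𝒰 = Set.univ →
    ∃ 𝒱 : Set (Set X), 𝒱 ⊆ 𝒰 ∧ 𝒱.Finite ∧ ⋃₀ 𝒱 = Set.univ

/-- The strict tree order on a tree π-base: `s < t` iff `t ⊆* s` but not `s ⊆* t`. -/
def TreeLT (s t : Set ℕ) : Prop := AlmostSubset t s ∧ ¬ AlmostSubset s t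

/-- The set of strict predecessors of `t` inside `T`. -/
def predSet (T : Set (Set ℕ)) (t : Set ℕ) : Set (Set ℕ) := {s ∈ T | TreeLT s t}

/-- The strict order restricted to the predecessors of `t` in `T`. -/
def predRel (T : Set (Set ℕ)) (t : Set ℕ) : predSet T t → predSet T t → Prop :=
  fun a b => TreeLT a.1 b.1

/-- The set of strict predecessors of `t` in `T` is well-ordered with order type `ξ`. -/
def HasPredOrderType (T : Set (Set ℕ)) (t : Set ℕ) (ξ : Ordinal) : Prop :=
  ∃ h : IsWellOrder (predSet T t) (predRel T t), @Ordinal.type _ (predRel T t) h = ξ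

/-- The `ξ`-th level of `T`: elements whose set of strict predecessors has order type `ξ`. -/
def TreeLevel (T : Set (Set ℕ)) (ξ : Ordinal) : Set (Set ℕ) :=
  {t ∈ T | HasPredOrderType T t ξ}

/-- A maximal almost disjoint family of infinite subsets of `ℕ`. -/
def IsMadFamily (A : Set (Set ℕ)) : Prop :=
  (∀ a ∈ A, a.Infinite) ∧
  (∀ a ∈ A, ∀ b ∈ A, a ≠ b → (a ∩ b).Finite) ∧
  (∀ x : Set ℕ, x.Infinite → ∃ a ∈ A, (x ∩ a).Infinite)

/-- `T` is a tree π-base for `ω*`. -/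
structure IsTreePiBase (T : Set (Set ℕ)) : Prop where
  /-- members are infinite subsets of `ℕ` -/
  infinite_mem : ∀ t ∈ T, t.Infinite
  /-- `T` is a tree: the strict predecessors of each element are well-ordered -/
  tree : ∀ t ∈ T, IsWellOrder (predSet T t) (predRel T t)
  /-- each nonempty level is an infinite maximal almost disjoint family -/
  levels : ∀ ξ : Ordinal, (TreeLevel T ξ).Nonempty →
    (TreeLevel T ξ).Infinite ∧ IsMadFamily (TreeLevel T ξ)
  /-- `T` is a π-base: every infinite `A ⊆ ℕ` almost contains a member of `T` -/
  pibase : ∀ A : Set ℕ, A.Infinite → ∃ t ∈ T, AlmostSubset t A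

/-- `ξ` is the height of `T`: the least ordinal whose level is empty. -/
def IsHeight (T : Set (Set ℕ)) (ξ : Ordinal) : Prop :=
  TreeLevel T ξ = ∅ ∧ ∀ η : Ordinal, η < ξ → (TreeLevel T η).Nonempty

/-- A cofinal branch of `T`: a maximal chain (in the order `s ≤ t ↔ t ⊆* s`)
meeting every nonempty level. -/
def IsCofinalBranch (T b : Set (Set ℕ)) : Prop :=
  b ⊆ T ∧ IsChain (fun s t => AlmostSubset t s) b ∧
  (∀ c : Set (Set ℕ), c ⊆ T → IsChain (fun s t => AlmostSubset t s) c → b ⊆ c → b = c) ∧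
  ∀ ξ : Ordinal, (TreeLevel T ξ).Nonempty → (b ∩ TreeLevel T ξ).Nonempty

/-- The principle `(*)`: there is no tree π-base for `ω*` of height `< 𝔠`, and
every tree π-base of height `𝔠` has a cofinal branch. -/
def StarPrinciple : Prop :=
  (∀ T : Set (Set ℕ), ∀ ξ : Ordinal, IsTreePiBase T → IsHeight T ξ →
      ¬ ξ < Cardinal.continuum.ord) ∧
  (∀ T : Set (Set ℕ), IsTreePiBase T → IsHeight T Cardinal.continuum.ord →
      ∃ b : Set (Set ℕ), IsCofinalBranch T b)

open Set Filter Cardinal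

namespace AlmostSubset

variable {a b c : Set ℕ}

theorem of_subset (h : a ⊆ b) : AlmostSubset a b := by
  simp [AlmostSubset, sdiff_eq_empty.2 h]

theorem refl (a : Set ℕ) : AlmostSubset a a := of_subset subset_rfl

theorem trans (h : AlmostSubset a b) (h' : AlmostSubset b c) : AlmostSubset a c :=
  (Finite.union h h').subset fun x hx => by
    by_cases hb : x ∈ b
    · exact Or.inr ⟨hb, hx.2⟩
    · exact Or.inl ⟨hx.1, hb⟩

theorem infinite_inter (h : AlmostSubset a b) (hac : (a ∩ c).Infinite) : (b ∩ c).Infinite :=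
  fun hf => hac <| (Finite.union h hf).subset fun x hx => by
    by_cases hb : x ∈ b
    · exact Or.inr ⟨hb, hx.2⟩
    · exact Or.inl ⟨hx.1, hb⟩

theorem infinite_inter_self (h : AlmostSubset a b) (ha : a.Infinite) : (a ∩ b).Infinite := by
  rw [inter_comm]
  exact h.infinite_inter (by rwa [inter_self])

theorem image {f : ℕ → ℕ} (h : AlmostSubset a b) :
    AlmostSubset (f '' a) (f '' b) := by
  refine (Finite.image f h).subset ?_
  rintro _ ⟨⟨x, hx, rfl⟩, hn⟩
  exact ⟨x, ⟨hx, fun hb => hn ⟨x, hb, rfl⟩⟩, rfl⟩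

end AlmostSubset

/-- An infinite set almost contained in two members of an almost disjoint family determines
the member. -/
theorem IsMadFamily.eq_of_inter_infinite {M : Set (Set ℕ)} (hM : IsMadFamily M) {s t : Set ℕ}
    (hs : s ∈ M) (ht : t ∈ M) (h : (s ∩ t).Infinite) : s = t := by
  by_contra hne
  exact h (hM.2.1 s hs t ht hne)

/-- A decreasing sequence of infinite sets has an infinite pseudo-intersection. -/
theorem exists_pseudoIntersection (N : ℕ → Set ℕ) (hN : ∀ n, (N n).Infinite)
    (hanti : Antitone N) : ∃ B : Set ℕ, B.Infinite ∧ ∀ n, AlmostSubset B (N n) := by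
  obtain ⟨φ, hφ, hmem⟩ := extraction_forall_of_frequently
    (P := fun n k => k ∈ N n) fun n => Nat.frequently_atTop_iff_infinite.2 (hN n)
  refine ⟨range φ, infinite_range_of_injective hφ.injective, fun n => ?_⟩
  refine ((finite_Iio n).image φ).subset ?_
  rintro _ ⟨⟨k, rfl⟩, hk⟩
  refine ⟨k, ?_, rfl⟩
  by_contra hkn
  exact hk (hanti (not_lt.1 hkn) (hmem k))

/-- Every infinite set of naturals has an infinite subset with infinite complement in it. -/
theorem exists_infinite_subset_not_almostSubset {A : Set ℕ} (hA : A.Infinite) :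
    ∃ B ⊆ A, B.Infinite ∧ ¬ AlmostSubset A B := by
  have e := hA.natEmbedding
  have hinj : Function.Injective fun n => (e n : ℕ) :=
    Subtype.val_injective.comp e.injective
  refine ⟨range fun n => (e (2 * n) : ℕ), ?_, ?_, ?_⟩
  · rintro _ ⟨n, rfl⟩
    exact (e _).2
  · exact infinite_range_of_injective fun m n h => by have := hinj h; omega
  · refine Infinite.mono (s := range fun n => (e (2 * n + 1) : ℕ)) ?_
      (infinite_range_of_injective fun m n h => by have := hinj h; omega)
    rintro _ ⟨n, rfl⟩
    refine ⟨(e _).2, ?_⟩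
    rintro ⟨m, hm⟩
    have := hinj hm
    omega

/-- `E` is open and dense in the forcing order of infinite sets of naturals under `⊆*`. -/
def OpenDense (E : Set (Set ℕ)) : Prop :=
  (∀ B ∈ E, ∀ C, AlmostSubset C B → C ∈ E) ∧
  ∀ A : Set ℕ, A.Infinite → ∃ B ∈ E, B.Infinite ∧ AlmostSubset B A

/-- Any family of open dense sets indexed by the ordinals below `κ` has open dense
intersection. -/
def DistributiveAt (κ : Ordinal.{0}) : Prop :=
  ∀ D : Ordinal.{0} → Set (Set ℕ), (∀ α < κ, OpenDense (D α)) →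
    OpenDense {A | ∀ α < κ, A ∈ D α}

namespace OpenDense

variable {D E : Set (Set ℕ)}

theorem inter (hD : OpenDense D) (hE : OpenDense E) : OpenDense (D ∩ E) := by
  refine ⟨fun B hB C hC => ⟨hD.1 B hB.1 C hC, hE.1 B hB.2 C hC⟩, fun A hA => ?_⟩
  obtain ⟨B, hB, hBi, hBA⟩ := hD.2 A hA
  obtain ⟨C, hC, hCi, hCB⟩ := hE.2 B hBi
  exact ⟨C, ⟨hD.1 B hB C hCB, hC⟩, hCi, hCB.trans hBA⟩

theorem exists_subset (hD : OpenDense D) {A : Set ℕ} (hA : A.Infinite) :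
    ∃ B ∈ D, B.Infinite ∧ B ⊆ A := by
  obtain ⟨B, hB, hBi, hBA⟩ := hD.2 A hA
  exact ⟨B ∩ A, hD.1 B hB _ (.of_subset inter_subset_left), hBA.infinite_inter_self hBi,
    inter_subset_right⟩

/-- Countably many open dense sets have open dense intersection. -/
theorem iInter {D : ℕ → Set (Set ℕ)} (hD : ∀ n, OpenDense (D n)) :
    OpenDense {A | ∀ n, A ∈ D n} := by
  refine ⟨fun B hB C hC n => (hD n).1 B (hB n) C hC, fun A hA => ?_⟩
  choose! F hF using fun n (B : Set ℕ) (hB : B.Infinite) => (hD n).exists_subset hB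
  let N : ℕ → Set ℕ := fun n => Nat.rec (F 0 A) (fun n B => F (n + 1) B) n
  have hN : ∀ n, (N n).Infinite := fun n => by
    induction n with
    | zero => exact (hF 0 A hA).2.1
    | succ n ih => exact (hF (n + 1) _ ih).2.1
  have hND : ∀ n, N n ∈ D n := fun n => by
    cases n with
    | zero => exact (hF 0 A hA).1
    | succ n => exact (hF (n + 1) _ (hN n)).1
  obtain ⟨B, hB, hBN⟩ := exists_pseudoIntersection N hN
    (antitone_nat_of_succ_le fun n => (hF (n + 1) _ (hN n)).2.2)
  exact ⟨B, fun n => (hD n).1 _ (hND n) B (hBN n), hB,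
    (hBN 0).trans (.of_subset (hF 0 A hA).2.2)⟩

/-- Every open dense set contains a maximal almost disjoint family. -/
theorem exists_isMadFamily (hD : OpenDense D) : ∃ M ⊆ D, IsMadFamily M := by
  obtain ⟨M, hM⟩ := zorn_subset
    {M : Set (Set ℕ) | (∀ a ∈ M, a ∈ D ∧ a.Infinite) ∧
      ∀ a ∈ M, ∀ b ∈ M, a ≠ b → (a ∩ b).Finite} (by
    intro c hc hchain
    refine ⟨⋃₀ c, ⟨?_, ?_⟩, fun s hs => subset_sUnion_of_mem hs⟩
    · rintro a ⟨s, hs, ha⟩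
      exact (hc hs).1 a ha
    · rintro a ⟨s, hs, ha⟩ b ⟨t, ht, hb⟩ hab
      rcases hchain.total hs ht with h | h
      · exact (hc ht).2 a (h ha) b hb hab
      · exact (hc hs).2 a ha b (h hb) hab)
  refine ⟨M, fun a ha => (hM.prop.1 a ha).1, fun a ha => (hM.prop.1 a ha).2, hM.prop.2, ?_⟩
  intro x hx
  by_contra! hcon
  obtain ⟨B, hB, hBi, hBx⟩ := hD.exists_subset hx
  have hfin : ∀ a ∈ M, (B ∩ a).Finite := fun a ha =>
    (hcon a ha).subset (inter_subset_inter_left a hBx)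
  have hins : insert B M ⊆ M := by
    refine hM.le_of_ge ⟨?_, ?_⟩ (subset_insert B M)
    · rintro a (rfl | ha)
      · exact ⟨hB, hBi⟩
      · exact hM.prop.1 a ha
    · rintro a (rfl | ha) b (rfl | hb) hab
      · exact absurd rfl hab
      · exact hfin b hb
      · rw [inter_comm]
        exact hfin a ha
      · exact hM.prop.2 a ha b hb hab
  have := hfin B (hins (mem_insert B M))
  rw [inter_self] at this
  exact hBi this

/-- Every open dense set contains an infinite maximal almost disjoint family. -/
theorem exists_infinite_isMadFamily (hD : OpenDense D) :
    ∃ M ⊆ D, M.Infinite ∧ IsMadFamily M := by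
  let P : ℕ → Set ℕ := fun n => {k | k.unpair.1 = n}
  have hP : ∀ n, (P n).Infinite := fun n =>
    (infinite_range_of_injective (f := fun m => Nat.pair n m)
      fun a b h => (Nat.pair_eq_pair.1 h).2).mono (by rintro _ ⟨m, rfl⟩; simp [P])
  have hE : OpenDense {B | (∃ n, AlmostSubset B (P n)) ∨ ∀ n, (B ∩ P n).Finite} := by
    refine ⟨?_, fun A hA => ?_⟩
    · rintro B (⟨n, hn⟩ | hB) C hC
      · exact Or.inl ⟨n, hC.trans hn⟩
      · exact Or.inr fun n => by
          by_contra h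
          exact hC.infinite_inter h (hB n)
    · by_cases h : ∃ n, (A ∩ P n).Infinite
      · obtain ⟨n, hn⟩ := h
        exact ⟨_, Or.inl ⟨n, .of_subset inter_subset_right⟩, hn, .of_subset inter_subset_left⟩
      · push Not at h
        exact ⟨A, Or.inr h, hA, .refl A⟩
  obtain ⟨M, hMD, hM⟩ := (hD.inter hE).exists_isMadFamily
  refine ⟨M, fun a ha => (hMD ha).1, ?_, hM⟩
  choose f hfM hf using fun n => hM.2.2 (P n) (hP n)
  refine (infinite_range_of_injective (f := f) fun m n hmn => ?_).mono (range_subset_iff.2 hfM)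
  have key : ∀ m, AlmostSubset (f m) (P m) := fun m => by
    have hm := hf m
    rw [inter_comm] at hm
    rcases (hMD (hfM m)).2 with ⟨k, hk⟩ | h
    · obtain ⟨x, hx⟩ := (hk.infinite_inter hm).nonempty
      have : k = m := hx.1.symm.trans hx.2
      exact this ▸ hk
    · exact absurd (h m) hm
  have hm := hf n
  rw [← hmn, inter_comm] at hm
  obtain ⟨x, hx⟩ := ((key m).infinite_inter hm).nonempty
  exact hx.1.symm.trans hx.2

end OpenDense

theorem IsMadFamily.openDense_treeLT {M : Set (Set ℕ)} (hM : IsMadFamily M) :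
    OpenDense {B | ∃ s ∈ M, TreeLT s B} := by
  refine ⟨?_, fun A hA => ?_⟩
  · rintro B ⟨s, hs, hBs, hsB⟩ C hC
    exact ⟨s, hs, hC.trans hBs, fun h => hsB (h.trans hC)⟩
  · obtain ⟨s, hs, hAs⟩ := hM.2.2 A hA
    obtain ⟨B, hB, hBi, hBn⟩ := exists_infinite_subset_not_almostSubset hAs
    exact ⟨B, ⟨s, hs, .of_subset (hB.trans inter_subset_right), fun h =>
      hBn ((AlmostSubset.of_subset inter_subset_right).trans h)⟩, hBi,
      .of_subset (hB.trans inter_subset_left)⟩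

/-- `L` is a matrix of height `κ`: for `α < κ` the families `L α` are infinite and maximal almost
disjoint, and each of them strictly refines all the earlier ones. -/
structure IsRefiningMatrix (κ : Ordinal.{0}) (L : Ordinal.{0} → Set (Set ℕ)) : Prop where
  infinite : ∀ α < κ, (L α).Infinite
  mad : ∀ α < κ, IsMadFamily (L α)
  refines : ∀ α < κ, ∀ β < α, ∀ t ∈ L α, ∃ s ∈ L β, TreeLT s t

/-- Under distributivity below `κ`, there is a refining matrix inside a given sequence of open
dense sets. -/
theorem exists_isRefiningMatrix {κ : Ordinal.{0}} (hκ : ∀ α < κ, DistributiveAt α)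
    {D : Ordinal.{0} → Set (Set ℕ)} (hD : ∀ α < κ, OpenDense (D α)) :
    ∃ L, IsRefiningMatrix κ L ∧ ∀ α < κ, L α ⊆ D α := by
  classical
  let E : ∀ α : Ordinal.{0}, (∀ β, β < α → Set (Set ℕ)) → Set (Set ℕ) := fun α prev =>
    {B | B ∈ D α ∧ ∀ β (h : β < α), ∃ s ∈ prev β h, TreeLT s B}
  let F : ∀ α : Ordinal.{0}, (∀ β, β < α → Set (Set ℕ)) → Set (Set ℕ) := fun α prev =>
    if h : ∃ M ⊆ E α prev, M.Infinite ∧ IsMadFamily M then h.choose else ∅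
  let L : Ordinal.{0} → Set (Set ℕ) := WellFounded.fix (wellFounded_lt (α := Ordinal.{0})) F
  have hL : ∀ α, L α = F α fun β _ => L β := fun α => WellFounded.fix_eq _ _ _
  have key : ∀ α < κ, L α ⊆ E α (fun β _ => L β) ∧ (L α).Infinite ∧ IsMadFamily (L α) := by
    intro α
    induction α using WellFoundedLT.induction with
    | ind α ih =>
      intro hα
      have hdist := hκ α hα (fun β => {B | ∃ s ∈ L β, TreeLT s B}) fun β hβ =>
        (ih β hβ (hβ.trans hα)).2.2.openDense_treeLT
      have hex : ∃ M ⊆ E α (fun β _ => L β), M.Infinite ∧ IsMadFamily M :=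
        ((hD α hα).inter hdist).exists_infinite_isMadFamily
      have : L α = hex.choose := by
        rw [hL]
        exact dif_pos hex
      rw [this]
      exact hex.choose_spec
  exact ⟨L, ⟨fun α hα => (key α hα).2.1, fun α hα => (key α hα).2.2,
    fun α hα β hβ t ht => ((key α hα).1 ht).2 β hβ⟩, fun α hα t ht => ((key α hα).1 ht).1⟩

namespace IsRefiningMatrix

variable {κ : Ordinal.{0}} {L : Ordinal.{0} → Set (Set ℕ)}

/-- The tree formed by all the members of a refining matrix. -/
def tree (κ : Ordinal.{0}) (L : Ordinal.{0} → Set (Set ℕ)) : Set (Set ℕ) :=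
  {t | ∃ α < κ, t ∈ L α}

theorem not_treeLT_of_mem (hL : IsRefiningMatrix κ L) {α β : Ordinal.{0}} (hα : α < κ)
    (hβα : β ≤ α) {s t : Set ℕ} (hs : s ∈ L α) (ht : t ∈ L β) : ¬ TreeLT s t := by
  intro hst
  have hti := (hL.mad β (hβα.trans_lt hα)).1 t ht
  have hinter := hst.1.infinite_inter_self hti
  rcases hβα.eq_or_lt with rfl | hlt
  · obtain rfl := (hL.mad β hα).eq_of_inter_infinite ht hs hinter
    exact hst.2 hst.1
  · obtain ⟨r, hr, hrs⟩ := hL.refines α hα β hlt s hs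
    obtain rfl := (hL.mad β (hlt.trans hα)).eq_of_inter_infinite hr ht
      (hrs.1.infinite_inter (by rwa [inter_comm]))
    exact hst.2 hrs.1

/-- The predecessors of a member of `L α` in the tree are ordered like `α`. -/
theorem exists_pred_relIso (hL : IsRefiningMatrix κ L) {α : Ordinal.{0}} (hα : α < κ) {t : Set ℕ}
    (ht : t ∈ L α) :
    Nonempty ((· < · : α.ToType → α.ToType → Prop) ≃r predRel (tree κ L) t) := by
  choose! f hfL hft using fun β (hβ : β < α) => hL.refines α hα β hβ t ht
  have hti := (hL.mad α hα).1 t ht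
  have huniq : ∀ β < α, ∀ s ∈ L β, TreeLT s t → s = f β := fun β hβ s hs hst =>
    (hL.mad β (hβ.trans hα)).eq_of_inter_infinite hs (hfL β hβ) <|
      hst.1.infinite_inter ((hft β hβ).1.infinite_inter_self hti)
  have hmono : ∀ β γ, β < γ → γ < α → TreeLT (f β) (f γ) := fun β γ hβγ hγ => by
    obtain ⟨s, hs, hsf⟩ := hL.refines γ (hγ.trans hα) β hβγ (f γ) (hfL γ hγ)
    have hst : TreeLT s t :=
      ⟨(hft γ hγ).1.trans hsf.1, fun h => (hft γ hγ).2 (hsf.1.trans h)⟩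
    rwa [← huniq β (hβγ.trans hγ) s hs hst]
  have hanti : ∀ β γ, β < α → γ < α → TreeLT (f β) (f γ) → β < γ := fun β γ hβ hγ h => by
    by_contra! hle
    exact hL.not_treeLT_of_mem (hβ.trans hα) hle (hfL β hβ) (hfL γ hγ) h
  have hlt : ∀ i : α.ToType, (i.toOrd : Ordinal) < α := fun i => i.toOrd.2
  let g : α.ToType → predSet (tree κ L) t := fun i =>
    ⟨f i.toOrd, ⟨_, (hlt i).trans hα, hfL _ (hlt i)⟩, hft _ (hlt i)⟩
  have hiff : ∀ i j, predRel (tree κ L) t (g i) (g j) ↔ i < j := fun i j => by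
    rw [← Ordinal.ToType.mk.symm.lt_iff_lt]
    exact ⟨fun h => hanti _ _ (hlt i) (hlt j) h, fun h => hmono _ _ h (hlt j)⟩
  have hbij : Function.Bijective g := by
    refine ⟨fun i j hij => ?_, ?_⟩
    · rcases lt_trichotomy i j with h | h | h
      · have := (hiff i j).2 h
        rw [hij] at this
        exact absurd ((hiff j j).1 this) (lt_irrefl j)
      · exact h
      · have := (hiff j i).2 h
        rw [hij] at this
        exact absurd ((hiff j j).1 this) (lt_irrefl j)
    · rintro ⟨s, ⟨β, hβ, hs⟩, hst⟩
      have hβα : β < α := by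
        by_contra! hle
        exact hL.not_treeLT_of_mem hβ hle hs ht hst
      refine ⟨Ordinal.ToType.mk ⟨β, hβα⟩, Subtype.ext ?_⟩
      simp only [g, Ordinal.ToType.toOrd, OrderIso.symm_apply_apply]
      exact (huniq β hβα s hs hst).symm
  exact ⟨⟨Equiv.ofBijective g hbij, fun {i j} => hiff i j⟩⟩

theorem isWellOrder_predRel (hL : IsRefiningMatrix κ L) {t : Set ℕ} (ht : t ∈ tree κ L) :
    IsWellOrder (predSet (tree κ L) t) (predRel (tree κ L) t) := by
  obtain ⟨α, hα, htα⟩ := ht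
  obtain ⟨e⟩ := hL.exists_pred_relIso hα htα
  exact e.symm.toRelEmbedding.isWellOrder

theorem hasPredOrderType (hL : IsRefiningMatrix κ L) {α : Ordinal.{0}} (hα : α < κ) {t : Set ℕ}
    (ht : t ∈ L α) : HasPredOrderType (tree κ L) t α := by
  obtain ⟨e⟩ := hL.exists_pred_relIso hα ht
  have := hL.isWellOrder_predRel ⟨α, hα, ht⟩
  exact ⟨this, (Ordinal.type_eq.2 ⟨e.symm⟩).trans (Ordinal.type_toType α)⟩

theorem mem_treeLevel_iff (hL : IsRefiningMatrix κ L) {ξ : Ordinal.{0}} {t : Set ℕ} :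
    t ∈ TreeLevel (tree κ L) ξ ↔ ξ < κ ∧ t ∈ L ξ := by
  constructor
  · rintro ⟨⟨α, hα, ht⟩, h, rfl⟩
    obtain ⟨h', hα'⟩ := hL.hasPredOrderType hα ht
    rw [hα']
    exact ⟨hα, ht⟩
  · rintro ⟨hξ, ht⟩
    exact ⟨⟨ξ, hξ, ht⟩, hL.hasPredOrderType hξ ht⟩

theorem treeLevel_eq (hL : IsRefiningMatrix κ L) {ξ : Ordinal.{0}} (hξ : ξ < κ) :
    TreeLevel (tree κ L) ξ = L ξ := by
  ext t
  simp [hL.mem_treeLevel_iff, hξ]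

theorem isHeight (hL : IsRefiningMatrix κ L) : IsHeight (tree κ L) κ := by
  refine ⟨?_, fun η hη => ?_⟩
  · ext t
    simp [hL.mem_treeLevel_iff]
  · rw [hL.treeLevel_eq hη]
    exact (hL.infinite η hη).nonempty

theorem isTreePiBase (hL : IsRefiningMatrix κ L)
    (hπ : ∀ A : Set ℕ, A.Infinite → ∃ α < κ, ∃ t ∈ L α, AlmostSubset t A) :
    IsTreePiBase (tree κ L) where
  infinite_mem := by
    rintro t ⟨α, hα, ht⟩
    exact (hL.mad α hα).1 t ht
  tree t ht := hL.isWellOrder_predRel ht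
  levels ξ hξ := by
    obtain ⟨t, ht⟩ := hξ
    have hξκ := (hL.mem_treeLevel_iff.1 ht).1
    rw [hL.treeLevel_eq hξκ]
    exact ⟨hL.infinite ξ hξκ, hL.mad ξ hξκ⟩
  pibase A hA := by
    obtain ⟨α, hα, t, ht, htA⟩ := hπ A hA
    exact ⟨t, ⟨α, hα, ht⟩, htA⟩

end IsRefiningMatrix

/-- The sets decided by `A`, that is, almost contained in `A` or almost disjoint from `A`, form an
open dense set. -/
theorem openDense_decides (A : Set ℕ) : OpenDense {B | AlmostSubset B A ∨ (B ∩ A).Finite} := by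
  refine ⟨?_, fun C hC => ?_⟩
  · rintro B (hB | hB) C hC
    · exact Or.inl (hC.trans hB)
    · exact Or.inr (by_contra fun h => hC.infinite_inter h hB)
  · by_cases h : (C ∩ A).Finite
    · exact ⟨C, Or.inr h, hC, .refl C⟩
    · exact ⟨_, Or.inl (.of_subset inter_subset_right), h, .of_subset inter_subset_left⟩

/-- At most `𝔠` many open dense sets can be arranged in a sequence of length `𝔠`. -/
theorem exists_openDense_sequence {I : Type} (hI : #I ≤ continuum) {Q : I → Set (Set ℕ)}
    (hQ : ∀ i, OpenDense (Q i)) :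
    ∃ D : Ordinal.{0} → Set (Set ℕ), (∀ α, OpenDense (D α)) ∧
      ∀ i, ∃ α < continuum.ord, D α ⊆ Q i := by
  have hI' : #I ≤ #(continuum.{0}.ord.ToType) := by rwa [mk_ord_toType]
  obtain ⟨g⟩ := hI'
  have hinj : ∀ i j, ((g i).toOrd : Ordinal) = (g j).toOrd → i = j := fun i j h =>
    g.injective (Ordinal.ToType.mk.symm.injective (Subtype.ext h))
  refine ⟨fun α => {B | ∀ i, ((g i).toOrd : Ordinal) = α → B ∈ Q i}, fun α => ⟨?_, ?_⟩,
    fun i => ⟨(g i).toOrd, (g i).toOrd.2, fun B hB => hB i rfl⟩⟩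
  · exact fun B hB C hC i hi => (hQ i).1 B (hB i hi) C hC
  · intro A hA
    by_cases h : ∃ i, ((g i).toOrd : Ordinal) = α
    · obtain ⟨i, rfl⟩ := h
      obtain ⟨B, hB, hBi, hBA⟩ := (hQ i).2 A hA
      exact ⟨B, fun j hj => hinj j i hj ▸ hB, hBi, hBA⟩
    · exact ⟨A, fun i hi => absurd ⟨i, hi⟩ h, hA, .refl A⟩

/-- The sequence `x` converges to `y` along the set `B`. -/
def ConvergesOn {X : Type*} [TopologicalSpace X] (x : ℕ → X) (B : Set ℕ) (y : X) : Prop :=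
  ∀ U : Set X, IsOpen U → y ∈ U → AlmostSubset B (x ⁻¹' U)

theorem openDense_convergesOn {X : Type*} [TopologicalSpace X] [SeqCompactSpace X] (x : ℕ → X) :
    OpenDense {B | ∃ y, ConvergesOn x B y} := by
  refine ⟨?_, fun A hA => ?_⟩
  · rintro B ⟨y, hy⟩ C hC
    exact ⟨y, fun U hU hyU => hC.trans (hy U hU hyU)⟩
  · classical
    have hinf : Infinite A := hA.to_subtype
    let e := Nat.orderEmbeddingOfSet A
    have heA : ∀ n, e n ∈ A := fun n => by
      rw [← Nat.orderEmbeddingOfSet_range A]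
      exact mem_range_self n
    obtain ⟨y, φ, hφ, hlim⟩ := SeqCompactSpace.tendsto_subseq (x ∘ e)
    refine ⟨range (e ∘ φ), ⟨y, fun U hU hyU => ?_⟩,
      infinite_range_of_injective (e.injective.comp hφ.injective), .of_subset ?_⟩
    · have hev := hlim.eventually (hU.mem_nhds hyU)
      rw [← Nat.cofinite_eq_atTop, eventually_cofinite] at hev
      refine (hev.image (e ∘ φ)).subset ?_
      rintro _ ⟨⟨n, rfl⟩, hn⟩
      exact ⟨n, hn, rfl⟩
    · rintro _ ⟨n, rfl⟩
      exact heA _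

/-- A nonempty chain of infinite sets is contained in a nonprincipal ultrafilter together with
all the sets almost containing one of its members. -/
theorem exists_ultrafilter_of_isChain {b : Set (Set ℕ)} (hne : b.Nonempty)
    (hinf : ∀ t ∈ b, t.Infinite) (hb : IsChain (fun s t => AlmostSubset t s) b) :
    ∃ p : Ultrafilter ℕ, Nonprincipal p ∧ ∀ t ∈ b, ∀ A, AlmostSubset t A → A ∈ p := by
  let F : Filter ℕ :=
    { sets := {A | ∃ t ∈ b, AlmostSubset t A}
      univ_sets := hne.imp fun t ht => ⟨ht, .of_subset (subset_univ t)⟩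
      sets_of_superset := by
        rintro A B ⟨t, ht, htA⟩ hAB
        exact ⟨t, ht, htA.trans (.of_subset hAB)⟩
      inter_sets := by
        have key : ∀ {s t A B : Set ℕ}, AlmostSubset s t → AlmostSubset s A → AlmostSubset t B →
            AlmostSubset s (A ∩ B) := fun {s t A B} hst hsA htB =>
          (Finite.union hsA (hst.trans htB)).subset fun x hx => by
            by_cases hxA : x ∈ A
            · exact Or.inr ⟨hx.1, fun hxB => hx.2 ⟨hxA, hxB⟩⟩
            · exact Or.inl ⟨hx.1, hxA⟩
        rintro A B ⟨s, hs, hsA⟩ ⟨t, ht, htB⟩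
        rcases eq_or_ne s t with rfl | hst
        · exact ⟨s, hs, key (.refl s) hsA htB⟩
        · rcases hb hs ht hst with h | h
          · exact ⟨t, ht, inter_comm B A ▸ key h htB hsA⟩
          · exact ⟨s, hs, key h hsA htB⟩ }
  have hF : F.NeBot := by
    refine ⟨fun h => ?_⟩
    have hbot : ∅ ∈ F := h ▸ mem_bot
    obtain ⟨t, ht, hte⟩ := hbot
    rw [AlmostSubset, sdiff_empty] at hte
    exact hinf t ht hte
  refine ⟨Ultrafilter.of F, fun A hA hAp => ?_, fun t ht A htA =>
    Ultrafilter.of_le F ⟨t, ht, htA⟩⟩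
  obtain ⟨t, ht⟩ := hne
  refine Ultrafilter.compl_notMem_iff.2 hAp (Ultrafilter.of_le F ⟨t, ht, ?_⟩)
  exact hA.subset fun x hx => by_contra fun h => hx.2 h

/-- If distributivity holds below `𝔠` and all tree π-bases of height `𝔠` have cofinal branches,
then sequentially compact spaces of size at most `𝔠` are `p`-compact for a nonprincipal `p`. -/
theorem exists_pCompact_of_distributiveAt
    (hdist : ∀ α < continuum.{0}.ord, DistributiveAt α)
    (hbranch : ∀ T : Set (Set ℕ), IsTreePiBase T → IsHeight T continuum.ord →
      ∃ b : Set (Set ℕ), IsCofinalBranch T b)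
    (X : Type) [TopologicalSpace X] [SeqCompactSpace X] (hX : #X ≤ continuum) :
    ∃ p : Ultrafilter ℕ, Nonprincipal p ∧ PCompact X p := by
  have hseq : #(ℕ → X) ≤ continuum := by
    rw [← power_def, mk_nat]
    exact (power_le_power_right hX).trans_eq continuum_power_aleph0
  obtain ⟨D₁, hD₁, hD₁s⟩ := exists_openDense_sequence (I := Set ℕ)
    (by simp) openDense_decides
  obtain ⟨D₂, hD₂, hD₂s⟩ := exists_openDense_sequence hseq
    (openDense_convergesOn (X := X))
  obtain ⟨L, hL, hLD⟩ := exists_isRefiningMatrix hdist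
    (D := fun α => D₁ α ∩ D₂ α) fun α _ => (hD₁ α).inter (hD₂ α)
  have hpi : IsTreePiBase (IsRefiningMatrix.tree continuum.ord L) := by
    refine hL.isTreePiBase fun A hA => ?_
    obtain ⟨α, hα, hDα⟩ := hD₁s A
    obtain ⟨t, ht, hAt⟩ := (hL.mad α hα).2.2 A hA
    refine ⟨α, hα, t, ht, ?_⟩
    rcases hDα (hLD α hα ht).1 with h | h
    · exact h
    · rw [inter_comm] at h
      exact absurd h hAt
  obtain ⟨b, hbT, hchain, -, hmeet⟩ := hbranch _ hpi hL.isHeight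
  have hmeet' : ∀ α < continuum.ord, ∃ t ∈ b, t ∈ L α := fun α hα => by
    have h := hL.treeLevel_eq hα
    obtain ⟨t, htb, htL⟩ := hmeet α (by rw [h]; exact (hL.infinite α hα).nonempty)
    exact ⟨t, htb, h ▸ htL⟩
  have hne : b.Nonempty := by
    obtain ⟨t, ht, -⟩ := hmeet' 0 (by simp [pos_iff_ne_zero, continuum_ne_zero])
    exact ⟨t, ht⟩
  obtain ⟨p, hp, hbp⟩ := exists_ultrafilter_of_isChain hne
    (fun t ht => hpi.infinite_mem t (hbT ht)) hchain
  refine ⟨p, hp, fun x => ?_⟩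
  obtain ⟨α, hα, hDα⟩ := hD₂s x
  obtain ⟨t, htb, htL⟩ := hmeet' α hα
  obtain ⟨y, hy⟩ := hDα (hLD α hα htL).2
  exact ⟨y, fun U hU hyU => hbp t htb _ (hy U hU hyU)⟩

/-- From at most `c` many sets of size at least `c` one can choose distinct elements. -/
theorem exists_injOn_choice {I β : Type} [Nonempty β] {c : Cardinal.{0}} (hI : #I ≤ c)
    {S : Set I} {F : I → Set β} (hF : ∀ i ∈ S, c ≤ #(F i)) :
    ∃ φ : I → β, InjOn φ S ∧ ∀ i ∈ S, φ i ∈ F i := by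
  classical
  have hI' : #I ≤ #c.ord.ToType := by rwa [mk_ord_toType]
  obtain ⟨g⟩ := hI'
  have hwf : WellFounded fun i j : I => g i < g j := InvImage.wf g wellFounded_lt
  let step : ∀ i, (∀ j, g j < g i → β) → β := fun i prev =>
    if h : ∃ x ∈ F i, ∀ j (hj : g j < g i), x ≠ prev j hj then h.choose else Classical.arbitrary β
  let φ : I → β := hwf.fix step
  have hφ : ∀ i ∈ S, φ i ∈ F i ∧ ∀ j, g j < g i → φ i ≠ φ j := by
    intro i hi
    have hsmall : #(φ '' {j | g j < g i}) < c := by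
      refine (mk_image_le.trans ?_).trans_lt ((mk_Iio_lt (g i) (by simp)).trans_eq (mk_ord_toType c))
      exact mk_le_of_injective (f := fun j : {j | g j < g i} => (⟨g j, j.2⟩ : Iio (g i)))
        fun a b hab => Subtype.ext (g.injective (congrArg Subtype.val hab))
    have hex : ∃ x ∈ F i, ∀ j, g j < g i → x ≠ φ j := by
      by_contra! hcon
      refine (hF i hi).not_gt ((mk_le_mk_of_subset fun x hx => ?_).trans_lt hsmall)
      obtain ⟨j, hj, hxj⟩ := hcon x hx
      exact ⟨j, hj, hxj.symm⟩
    have : φ i = hex.choose := by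
      rw [show φ i = step i fun j _ => φ j from hwf.fix_eq step i]
      exact dif_pos hex
    rw [this]
    exact hex.choose_spec
  refine ⟨φ, fun i hi j hj hij => ?_, fun i hi => (hφ i hi).1⟩
  rcases lt_trichotomy (g i) (g j) with h | h | h
  · exact absurd hij.symm ((hφ j hj).2 i h)
  · exact g.injective h
  · exact absurd hij ((hφ i hi).2 j h)

/-- The least ordinal at which distributivity fails has uncountable cofinality. -/
theorem exists_bound_of_not_distributiveAt {κ : Ordinal.{0}} (hκ : ∀ α < κ, DistributiveAt α)
    (hnot : ¬ DistributiveAt κ) (a : ℕ → Ordinal.{0}) (ha : ∀ n, a n < κ) :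
    ∃ β < κ, ∀ n, a n ≤ β := by
  by_contra! hcon
  refine hnot fun D hD => ?_
  have hD' : OpenDense {A | ∀ n, A ∈ {A | ∀ β < a n, A ∈ D β}} :=
    OpenDense.iInter fun n => hκ (a n) (ha n) D fun β hβ => hD β (hβ.trans (ha n))
  convert hD' using 1
  ext A
  constructor
  · exact fun h n β hβ => h β (hβ.trans (ha n))
  · intro h β hβ
    obtain ⟨n, hn⟩ := hcon β hβ
    exact h n β hn

/-- If distributivity fails at `κ`, then some sequence of open dense sets of length `κ` has no
infinite common member. -/
theorem exists_openDense_of_not_distributiveAt {κ : Ordinal.{0}} (hnot : ¬ DistributiveAt κ) :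
    ∃ D : Ordinal.{0} → Set (Set ℕ), (∀ α < κ, OpenDense (D α)) ∧
      ∀ A : Set ℕ, A.Infinite → ∃ α < κ, A ∉ D α := by
  classical
  simp only [DistributiveAt, not_forall] at hnot
  obtain ⟨D, hD, hno⟩ := hnot
  have hA : ∃ A : Set ℕ, A.Infinite ∧ ∀ B : Set ℕ, B.Infinite → AlmostSubset B A →
      ∃ α < κ, B ∉ D α := by
    by_contra! hcon
    refine hno ⟨fun B hB C hC α hα => (hD α hα).1 B (hB α hα) C hC, fun A hA => ?_⟩
    obtain ⟨B, hB, hBA, hBD⟩ := hcon A hA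
    exact ⟨B, hBD, hB, hBA⟩
  obtain ⟨A, hA, hAD⟩ := hA
  have hinf : Infinite A := hA.to_subtype
  let e := Nat.orderEmbeddingOfSet A
  have he : range e = A := Nat.orderEmbeddingOfSet_range A
  refine ⟨fun α => {B | e '' B ∈ D α}, fun α hα => ⟨?_, fun C hC => ?_⟩, fun B hB => ?_⟩
  · exact fun B hB C hC => (hD α hα).1 _ hB _ hC.image
  · obtain ⟨B, hB, hBi, hBC⟩ := (hD α hα).exists_subset (hC.image e.injective.injOn)
    have hBe : e '' (e ⁻¹' B) = B :=
      image_preimage_eq_of_subset (hBC.trans (image_subset_range e C))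
    refine ⟨e ⁻¹' B, ?_, ?_, .of_subset fun x hx => ?_⟩
    · simpa [hBe] using hB
    · rw [← hBe] at hBi
      exact hBi.of_image e
    · obtain ⟨y, hy, hyx⟩ := hBC hx
      exact e.injective hyx ▸ hy
  · exact hAD _ (hB.image e.injective.injOn)
      (.of_subset ((image_subset_range e B).trans he.subset))

/-- If every infinite set is split by some level of a refining matrix of uncountable cofinality,
then every infinite set meets `𝔠` many members of some level. -/
theorem IsRefiningMatrix.exists_continuum_le {κ : Ordinal.{0}} {L : Ordinal.{0} → Set (Set ℕ)}
    (hL : IsRefiningMatrix κ L)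
    (hcof : ∀ a : ℕ → Ordinal.{0}, (∀ n, a n < κ) → ∃ β < κ, ∀ n, a n ≤ β)
    (hsplit : ∀ A : Set ℕ, A.Infinite → ∃ α < κ, ∃ r : Bool → Set ℕ, r true ≠ r false ∧
      ∀ i, r i ∈ L α ∧ (A ∩ r i).Infinite) {A : Set ℕ} (hA : A.Infinite) :
    ∃ α < κ, continuum ≤ #{t ∈ L α | (A ∩ t).Infinite} := by
  choose! lev hlev r hr hrL using hsplit
  let node : List Bool → Set ℕ := fun l =>
    List.rec A (fun i _ B => B ∩ r B i) l
  have hnode : ∀ l, (node l).Infinite := fun l => by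
    induction l with
    | nil => exact hA
    | cons i l ih => exact (hrL _ ih i).2
  obtain ⟨u, hu⟩ := exists_surjective_nat (List Bool)
  obtain ⟨β, hβ, hbound⟩ := hcof (fun n => lev (node (u n))) fun n => hlev _ (hnode _)
  have hle : ∀ l, lev (node l) ≤ β := fun l => by
    obtain ⟨n, rfl⟩ := hu l
    exact hbound n
  let pre : (ℕ → Bool) → ℕ → List Bool := fun f n => Nat.rec [] (fun n l => f n :: l) n
  choose P hP hPN using fun f : ℕ → Bool => exists_pseudoIntersection (fun n => node (pre f n))
    (fun n => hnode _) (antitone_nat_of_succ_le fun n => inter_subset_left)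
  choose t htL hPt using fun f => (hL.mad β hβ).2.2 (P f) (hP f)
  have hbranch : ∀ f n, ∀ s ∈ L (lev (node (pre f n))), AlmostSubset (t f) s →
      s = r (node (pre f n)) (f n) := fun f n s hs hts => by
    have hPr : AlmostSubset (P f) (r (node (pre f n)) (f n)) :=
      (hPN f (n + 1)).trans (.of_subset inter_subset_right)
    refine (hL.mad _ (hlev _ (hnode _))).eq_of_inter_infinite hs (hrL _ (hnode _) _).1
      (hts.infinite_inter ?_)
    rw [inter_comm]
    exact hPr.infinite_inter (hPt f)
  have hinj : Function.Injective t := by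
    intro f g hfg
    by_contra hne
    have hex : ∃ n, f n ≠ g n := Function.ne_iff.1 hne
    classical
    have hpre : ∀ m ≤ Nat.find hex, pre f m = pre g m := fun m => by
      induction m with
      | zero => exact fun _ => rfl
      | succ m ih =>
        intro hm
        have h1 : f m = g m := not_not.1 (Nat.find_min hex hm)
        change f m :: pre f m = g m :: pre g m
        rw [h1, ih (Nat.le_of_succ_le hm)]
    have hn := Nat.find_spec hex
    have hpn := hpre _ le_rfl
    set n := Nat.find hex
    obtain ⟨s, hs, hts⟩ : ∃ s ∈ L (lev (node (pre f n))), AlmostSubset (t f) s := by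
      rcases (hle (pre f n)).eq_or_lt with h | h
      · exact ⟨t f, h ▸ htL f, .refl _⟩
      · obtain ⟨s, hs, hst⟩ := hL.refines β hβ _ h (t f) (htL f)
        exact ⟨s, hs, hst.1⟩
    have h1 := hbranch f n s hs hts
    have h2 := hbranch g n s (hpn ▸ hs) (hfg ▸ hts)
    rw [← hpn, h1] at h2
    have h3 := hr _ (hnode (pre f n))
    cases hf : f n <;> cases hg : g n <;> simp_all
  refine ⟨β, hβ, ?_⟩
  have hcard : #(ℕ → Bool) = continuum := by simp
  rw [← hcard]
  refine mk_le_of_injective (f := fun f => (⟨t f, htL f, ?_⟩ : {t ∈ L β | (A ∩ t).Infinite}))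
    fun f g hfg => hinj (congrArg Subtype.val hfg)
  exact (hPN f 0).infinite_inter (hPt f)

/-- The Balcar–Pelant–Simon base matrix theorem: there is a tree π-base whose height is the least
ordinal at which distributivity fails. -/
theorem exists_isTreePiBase_isHeight {κ : Ordinal.{0}} (hκ : ∀ α < κ, DistributiveAt α)
    (hnot : ¬ DistributiveAt κ) : ∃ T, IsTreePiBase T ∧ IsHeight T κ := by
  obtain ⟨D, hD, hDno⟩ := exists_openDense_of_not_distributiveAt hnot
  obtain ⟨L, hL, hLD⟩ := exists_isRefiningMatrix hκ hD
  have hmany : ∀ A : Set ℕ, A.Infinite →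
      ∃ α < κ, continuum ≤ #{t ∈ L α | (A ∩ t).Infinite} := fun A hA => by
    refine hL.exists_continuum_le (exists_bound_of_not_distributiveAt hκ hnot) ?_ hA
    intro A hA
    obtain ⟨α, hα, hAα⟩ := hDno A hA
    obtain ⟨s, hs, hAs⟩ := (hL.mad α hα).2.2 A hA
    have hdiff : (A \ s).Infinite := fun h => hAα ((hD α hα).1 s (hLD α hα hs) A h)
    obtain ⟨t, ht, hAt⟩ := (hL.mad α hα).2.2 _ hdiff
    refine ⟨α, hα, fun i => if i then s else t, ?_, fun i => ?_⟩
    · rintro hst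
      obtain ⟨x, hx⟩ := hAt.nonempty
      simp only [if_true, Bool.false_eq_true, if_false] at hst
      exact hx.1.2 (hst ▸ hx.2)
    · cases i
      · exact ⟨by simpa using ht,
          hAt.mono (by simpa using inter_subset_inter_left t sdiff_subset)⟩
      · exact ⟨by simpa using hs, by simpa using hAs⟩
  choose φ hφinj hφ using fun α => exists_injOn_choice (I := Set ℕ) (c := continuum)
    (by simp) (S := {A | continuum ≤ #{t ∈ L α | (A ∩ t).Infinite}})
    (F := fun A => {t ∈ L α | (A ∩ t).Infinite}) fun A hA => hA
  let E : Ordinal.{0} → Set (Set ℕ) := fun α => {B | ∃ t ∈ L α, AlmostSubset B t ∧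
    ∀ A : Set ℕ, continuum ≤ #{t ∈ L α | (A ∩ t).Infinite} → φ α A = t →
      AlmostSubset B A ∨ (B ∩ A).Finite}
  have hE : ∀ α < κ, OpenDense (E α) := fun α hα => by
    refine ⟨?_, fun C hC => ?_⟩
    · rintro B ⟨t, ht, hBt, hB⟩ C hC
      exact ⟨t, ht, hC.trans hBt, fun A hA hAt => (openDense_decides A).1 B (hB A hA hAt) C hC⟩
    · obtain ⟨t, ht, hCt⟩ := (hL.mad α hα).2.2 C hC
      by_cases h : ∃ A : Set ℕ, continuum ≤ #{t ∈ L α | (A ∩ t).Infinite} ∧ φ α A = t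
      · obtain ⟨A, hA, hAt⟩ := h
        obtain ⟨B, hB, hBi, hBC⟩ := (openDense_decides A).exists_subset hCt
        refine ⟨B, ⟨t, ht, .of_subset (hBC.trans inter_subset_right), fun A' hA' hAt' => ?_⟩, hBi,
          .of_subset (hBC.trans inter_subset_left)⟩
        rwa [hφinj α hA' hA (hAt'.trans hAt.symm)]
      · exact ⟨C ∩ t, ⟨t, ht, .of_subset inter_subset_right, fun A hA hAt =>
          absurd ⟨A, hA, hAt⟩ h⟩, hCt, .of_subset inter_subset_left⟩
  obtain ⟨M, hM, hME⟩ := exists_isRefiningMatrix hκ hE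
  refine ⟨_, hM.isTreePiBase fun A hA => ?_, hM.isHeight⟩
  obtain ⟨α, hα, hAα⟩ := hmany A hA
  obtain ⟨htL, hAt⟩ := hφ α A hAα
  obtain ⟨B, hBM, hB⟩ := (hM.mad α hα).2.2 _ hAt
  obtain ⟨s, hs, hBs, hdec⟩ := hME α hα hBM
  have hts : φ α A = s := by
    refine (hL.mad α hα).eq_of_inter_infinite htL hs ?_
    rw [inter_comm]
    exact hBs.infinite_inter (hB.mono fun x hx => ⟨hx.2, hx.1.2⟩)
  refine ⟨α, hα, B, hBM, (hdec A hAα hts).resolve_right fun h => hB (h.subset ?_)⟩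
  exact fun x hx => ⟨hx.2, hx.1.1⟩

/-- Under the principle `(*)`, every sequentially compact space of cardinality at
most `𝔠` is `p`-compact for some nonprincipal ultrafilter `p` on `ℕ`. -/
theorem statement0 (hstar : StarPrinciple) (X : Type) [TopologicalSpace X]
    [SeqCompactSpace X] (hX : Cardinal.mk X ≤ Cardinal.continuum) :
    ∃ p : Ultrafilter ℕ, Nonprincipal p ∧ PCompact X p := by
  refine exists_pCompact_of_distributiveAt (fun α => ?_) hstar.2 X hX
  induction α using WellFoundedLT.induction with
  | ind α ih =>
    intro hα
    by_contra hnot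
    obtain ⟨T, hT, hheight⟩ :=
      exists_isTreePiBase_isHeight (fun β hβ => ih β hβ (hβ.trans hα)) hnot
    exact hstar.1 T α hT hheight hα
end

section
/- Let P be a set of nonprincipal ultrafilters on ℕ such that for every nonprincipal ultrafilter u on ℕ there exist a finite-to-one function f : ℕ → ℕ and some q ∈ P with the pushforward of u along f equal to q. If X is a topological space that is not q-compact for any q ∈ P, then X is not p-compact for any nonprincipal ultrafilter p on ℕ. -/
/-- If `P` is a set of nonprincipal ultrafilters such that every nonprincipal
ultrafilter maps onto some member of `P` by a finite-to-one map, then a space that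
is not `q`-compact for any `q ∈ P` is not `p`-compact for any nonprincipal `p`. -/
theorem statement3 {X : Type*} [TopologicalSpace X] (P : Set (Ultrafilter ℕ))
    (hPnp : ∀ q ∈ P, Nonprincipal q)
    (hcof : ∀ u : Ultrafilter ℕ, Nonprincipal u →
      ∃ f : ℕ → ℕ, FiniteToOne f ∧ ∃ q ∈ P, Ultrafilter.map f u = q)
    (hX : ∀ q ∈ P, ¬ PCompact X q) :
    ∀ p : Ultrafilter ℕ, Nonprincipal p → ¬ PCompact X p := by
  intro p hp hcompact
  obtain ⟨f, -, q, hq, rfl⟩ := hcof p hp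
  refine hX _ hq fun x => ?_
  obtain ⟨y, hy⟩ := hcompact (x ∘ f)
  exact ⟨y, fun U hU hyU => Ultrafilter.mem_map.2 (hy U hU hyU)⟩
end

section
/- Assume there is a set P of nonprincipal ultrafilters on ℕ of cardinality at most 𝔠 such that every q ∈ P is a P-point having a filter base that is a ⊆*-decreasing ω₁-sequence (u_α)_{α<ω₁} of infinite subsets of ℕ, and such that for every nonprincipal ultrafilter u on ℕ there exist a finite-to-one f : ℕ → ℕ and q ∈ P with the pushforward of u along f equal to q. Then there exists a Hausdorff topological space X that is separable, sequentially compact, of cardinality 𝔠, and not p-compact for any nonprincipal ultrafilter p on ℕ. -/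
/-- A nonprincipal ultrafilter `p` is a P-point if for every `f : ℕ → ℕ` there is
`A ∈ p` on which `f` is constant or finite-to-one. -/
def IsPPoint (p : Ultrafilter ℕ) : Prop :=
  Nonprincipal p ∧
  ∀ f : ℕ → ℕ, ∃ A ∈ p, (∃ c : ℕ, ∀ n ∈ A, f n = c) ∨ (∀ n : ℕ, (f ⁻¹' {n} ∩ A).Finite)

/-- `p` has a filter base which is a `⊆*`-decreasing `ω₁`-sequence of infinite
subsets of `ℕ`. -/
def HasTowerBase (p : Ultrafilter ℕ) : Prop :=
  ∃ u : {o : Ordinal.{0} // o < (Cardinal.aleph.{0} 1).ord} → Set ℕ,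
    (∀ α, (u α).Infinite) ∧
    (∀ α β, α.1 < β.1 → AlmostSubset (u β) (u α)) ∧
    (∀ A : Set ℕ, A ∈ p ↔ ∃ α, u α ⊆ A)

open Set Filter Topology

/-- The nodes of the full binary tree. -/
abbrev BinNode : Type := Σ n : ℕ, (Fin n → Bool)

/-- The node of length `n` on the branch `i`. -/
def branch (i : ℕ → Bool) (n : ℕ) : BinNode := ⟨n, fun k => i k⟩

lemma branch_injective (i : ℕ → Bool) : Function.Injective (branch i) := by
  intro m n h
  exact congrArg Sigma.fst h

lemma finite_range_branch_inter {i j : ℕ → Bool} (hij : i ≠ j) :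
    (range (branch i) ∩ range (branch j)).Finite := by
  obtain ⟨k, hk⟩ := Function.ne_iff.1 hij
  refine ((finite_Iic k).image (branch i)).subset ?_
  rintro _ ⟨⟨n, rfl⟩, ⟨m, hm⟩⟩
  refine ⟨n, ?_, rfl⟩
  by_contra hn
  have hn' : k < n := not_le.1 hn
  obtain rfl : m = n := congrArg Sigma.fst hm
  simp only [branch, Sigma.mk.injEq, heq_eq_eq, true_and] at hm
  exact hk (congrFun hm ⟨k, hn'⟩).symm

/-- The nodes of the binary tree, a copy of `W` for every branch, and a point at infinity. -/
inductive TowerSpace {W : Type} (u : (ℕ → Bool) → W → Set ℕ) : Type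
  | node (d : BinNode) : TowerSpace u
  | limit (i : ℕ → Bool) (α : W) : TowerSpace u
  | infty : TowerSpace u

namespace TowerSpace

variable {W : Type} {u : (ℕ → Bool) → W → Set ℕ}

lemma node_injective : Function.Injective (node : BinNode → TowerSpace u) := by
  intro a b h
  cases h
  rfl

/-- The nodes on the branch `i` together with the copy of `W` attached to it. -/
def strand (u : (ℕ → Bool) → W → Set ℕ) (i : ℕ → Bool) : Set (TowerSpace u) :=
  {x | match x with
    | node d => d ∈ range (branch i)
    | limit j _ => j = i
    | infty => False}

lemma finite_strand_inter {i j : ℕ → Bool} (hij : i ≠ j) :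
    (strand u i ∩ strand u j).Finite := by
  refine ((finite_range_branch_inter hij).image node).subset ?_
  rintro x ⟨hi, hj⟩
  cases x with
  | node d => exact ⟨d, ⟨hi, hj⟩, rfl⟩
  | limit k β => exact absurd (Eq.trans (Eq.symm hi) hj) hij
  | infty => exact hi.elim

lemma eventually_notMem {s : ℕ → TowerSpace u} (hs : Tendsto s atTop cofinite)
    {F : Set (TowerSpace u)} (hF : F.Finite) : ∀ᶠ n in atTop, s n ∉ F :=
  hs.eventually hF.eventually_cofinite_notMem

lemma mk_le_continuum (hW : Cardinal.mk W ≤ Cardinal.continuum) :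
    Cardinal.mk (TowerSpace u) ≤ Cardinal.continuum := by
  let g : Option (BinNode ⊕ (ℕ → Bool) × W) → TowerSpace u
    | none => infty
    | some (.inl d) => node d
    | some (.inr (i, α)) => limit i α
  have hg : Function.Surjective g := by
    rintro (d | ⟨i, α⟩ | _)
    · exact ⟨some (.inl d), rfl⟩
    · exact ⟨some (.inr (i, α)), rfl⟩
    · exact ⟨none, rfl⟩
  refine (Cardinal.mk_le_of_surjective hg).trans ?_
  have h1 : Cardinal.mk BinNode ≤ Cardinal.continuum :=
    Cardinal.mk_le_aleph0.trans Cardinal.aleph0_le_continuum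
  have h2 : Cardinal.mk (ℕ → Bool) ≤ Cardinal.continuum := by simp
  rw [Cardinal.mk_option, Cardinal.mk_sum, Cardinal.mk_prod]
  simp only [Cardinal.lift_id]
  refine Cardinal.add_le_of_le Cardinal.aleph0_le_continuum
    (Cardinal.add_le_of_le Cardinal.aleph0_le_continuum h1 ?_)
    (Cardinal.one_le_aleph0.trans Cardinal.aleph0_le_continuum)
  exact Cardinal.mul_le_of_le Cardinal.aleph0_le_continuum h2 hW

variable [LinearOrder W]

/-- The part of the strand `i` which lies below the level `α`. -/
def lower (u : (ℕ → Bool) → W → Set ℕ) (i : ℕ → Bool) (α : W) : Set (TowerSpace u) :=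
  {x | match x with
    | node d => d ∈ branch i '' (u i α)ᶜ
    | limit j β => j = i ∧ β ≤ α
    | infty => False}

/-- The sets declared to be clopen. -/
inductive IsBasic : Set (TowerSpace u) → Prop
  | singleton (d : BinNode) : IsBasic {node d}
  | strand (i : ℕ → Bool) : IsBasic (strand u i)
  | lower (i : ℕ → Bool) (α : W) : IsBasic (lower u i α)

instance : TopologicalSpace (TowerSpace u) :=
  TopologicalSpace.generateFrom {V | IsBasic V ∨ IsBasic Vᶜ}

lemma IsBasic.isOpen {S : Set (TowerSpace u)} (hS : IsBasic S) : IsOpen S :=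
  TopologicalSpace.isOpen_generateFrom_of_mem (Or.inl hS)

lemma IsBasic.isOpen_compl {S : Set (TowerSpace u)} (hS : IsBasic S) : IsOpen Sᶜ :=
  TopologicalSpace.isOpen_generateFrom_of_mem (Or.inr (by rwa [compl_compl]))

lemma tendsto_of_isBasic {s : ℕ → TowerSpace u} {y : TowerSpace u}
    (h : ∀ S, IsBasic S → ∀ᶠ n in atTop, (s n ∈ S ↔ y ∈ S)) : Tendsto s atTop (𝓝 y) := by
  rw [TopologicalSpace.tendsto_nhds_generateFrom_iff]
  rintro V (hV | hV) hy
  · filter_upwards [h V hV] with n hn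
    exact hn.2 hy
  · filter_upwards [h _ hV] with n hn
    by_contra hc
    exact hn.1 hc hy

lemma separated_of_isBasic {S : Set (TowerSpace u)} (hS : IsBasic S) {x y : TowerSpace u}
    (hx : x ∈ S) (hy : y ∉ S) :
    ∃ U V : Set (TowerSpace u), IsOpen U ∧ IsOpen V ∧ x ∈ U ∧ y ∈ V ∧ Disjoint U V :=
  ⟨S, Sᶜ, hS.isOpen, hS.isOpen_compl, hx, hy, disjoint_compl_right⟩

lemma exists_isBasic_of_ne {x y : TowerSpace u} (hxy : x ≠ y) :
    ∃ S, IsBasic S ∧ ((x ∈ S ∧ y ∉ S) ∨ (y ∈ S ∧ x ∉ S)) := by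
  cases x with
  | node d => exact ⟨_, .singleton d, Or.inl ⟨rfl, hxy.symm⟩⟩
  | infty =>
    cases y with
    | node d => exact ⟨_, .singleton d, Or.inr ⟨rfl, hxy⟩⟩
    | limit j β => exact ⟨_, .strand j, Or.inr ⟨rfl, id⟩⟩
    | infty => exact absurd rfl hxy
  | limit i α =>
    cases y with
    | node d => exact ⟨_, .singleton d, Or.inr ⟨rfl, hxy⟩⟩
    | infty => exact ⟨_, .strand i, Or.inl ⟨rfl, id⟩⟩
    | limit j β =>
      by_cases hij : j = i
      · subst hij
        rcases lt_trichotomy α β with h | h | h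
        · exact ⟨_, .lower j α, Or.inl ⟨⟨rfl, le_rfl⟩, fun hc => not_le.2 h hc.2⟩⟩
        · exact absurd (by rw [h]) hxy
        · exact ⟨_, .lower j β, Or.inr ⟨⟨rfl, le_rfl⟩, fun hc => not_le.2 h hc.2⟩⟩
      · exact ⟨_, .strand i, Or.inl ⟨rfl, hij⟩⟩

instance : T2Space (TowerSpace u) := by
  refine ⟨fun x y hxy => ?_⟩
  obtain ⟨S, hS, ⟨hx, hy⟩ | ⟨hy, hx⟩⟩ := exists_isBasic_of_ne hxy
  · exact separated_of_isBasic hS hx hy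
  · obtain ⟨U, V, hU, hV, hyU, hxV, hd⟩ := separated_of_isBasic hS hy hx
    exact ⟨V, U, hV, hU, hxV, hyU, hd.symm⟩

lemma lower_subset_strand (i : ℕ → Bool) (α : W) : lower u i α ⊆ strand u i := by
  intro x hx
  cases x with
  | node d =>
    obtain ⟨n, -, hn⟩ := hx
    exact ⟨n, hn⟩
  | limit j β => exact hx.1
  | infty => exact hx

lemma finite_lower_diff (hdec : ∀ i α β, α ≤ β → (u i β \ u i α).Finite)
    (i : ℕ → Bool) {α β : W} (h : α ≤ β) : (lower u i α \ lower u i β).Finite := by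
  refine ((hdec i α β h).image (fun n => node (branch i n))).subset ?_
  rintro x ⟨hα, hβ⟩
  cases x with
  | node d =>
    obtain ⟨n, hn, rfl⟩ := hα
    refine ⟨n, ⟨?_, hn⟩, rfl⟩
    by_contra hc
    exact hβ ⟨n, hc, rfl⟩
  | limit k γ => exact absurd ⟨hα.1, hα.2.trans h⟩ hβ
  | infty => exact hα.elim

lemma exists_tendsto_limit_of_lower [WellFoundedLT W]
    (hdec : ∀ i α β, α ≤ β → (u i β \ u i α).Finite)
    {s : ℕ → TowerSpace u} (hs : Tendsto s atTop cofinite) {i : ℕ → Bool}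
    (h : ∃ α, ∃ᶠ n in atTop, s n ∈ lower u i α) :
    ∃ α, ∃ φ : ℕ → ℕ, StrictMono φ ∧ Tendsto (s ∘ φ) atTop (𝓝 (limit i α)) := by
  obtain ⟨α, hα, hmin⟩ := WellFounded.has_min (wellFounded_lt (α := W))
    {α | ∃ᶠ n in atTop, s n ∈ lower u i α} h
  obtain ⟨φ, hφ, hmem⟩ := extraction_of_frequently_atTop hα
  have hsφ : Tendsto (s ∘ φ) atTop cofinite := hs.comp hφ.tendsto_atTop
  have hother : ∀ j, j ≠ i → ∀ᶠ n in atTop, (s ∘ φ) n ∉ strand u j := by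
    intro j hj
    filter_upwards [eventually_notMem hsφ (finite_strand_inter hj)] with n hn hc
    exact hn ⟨hc, lower_subset_strand i α (hmem n)⟩
  refine ⟨α, φ, hφ, tendsto_of_isBasic fun S hS => ?_⟩
  cases hS with
  | singleton d =>
    filter_upwards [eventually_notMem hsφ (finite_singleton (node d))] with n hn
    exact iff_of_false hn (by simp)
  | strand j =>
    by_cases hj : j = i
    · subst hj
      exact Eventually.of_forall fun n =>
        iff_of_true (lower_subset_strand j α (hmem n)) rfl
    · filter_upwards [hother j hj] with n hn
      exact iff_of_false hn (Ne.symm hj)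
  | lower j β =>
    by_cases hj : j = i
    · subst hj
      rcases le_or_gt α β with hβ | hβ
      · filter_upwards [eventually_notMem hsφ (finite_lower_diff hdec j hβ)] with n hn
        refine iff_of_true ?_ ⟨rfl, hβ⟩
        by_contra hc
        exact hn ⟨hmem n, hc⟩
      · have hev : ∀ᶠ n in atTop, s n ∉ lower u j β :=
          not_frequently.1 fun hc => hmin β hc hβ
        filter_upwards [hφ.tendsto_atTop.eventually hev] with n hn
        exact iff_of_false hn fun hc => not_le.2 hβ hc.2
    · filter_upwards [hother j hj] with n hn
      exact iff_of_false (fun hc => hn (lower_subset_strand j β hc)) fun hc => hj hc.1.symm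

lemma exists_frequently_mem_lower
    (hbdd : ∀ f : ℕ → W, ∃ b, ∀ n, f n ≤ b)
    (hsplit : ∀ i (B : Set ℕ), B.Infinite → ∃ α, (B \ u i α).Infinite)
    {s : ℕ → TowerSpace u} (hs : Tendsto s atTop cofinite) {i : ℕ → Bool}
    (h : ∃ᶠ n in atTop, s n ∈ strand u i) :
    ∃ α, ∃ᶠ n in atTop, s n ∈ lower u i α := by
  by_cases hn : ∃ᶠ n in atTop, s n ∈ (fun m => node (branch i m)) '' univ
  · have hinf : {m | ∃ n, s n = node (branch i m)}.Infinite := by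
      intro hfin
      refine hn ?_
      filter_upwards [eventually_notMem hs (hfin.image fun m => node (branch i m))] with n hn
      rintro ⟨m, -, hm⟩
      exact hn ⟨m, ⟨n, hm.symm⟩, hm⟩
    obtain ⟨α, hα⟩ := hsplit i _ hinf
    refine ⟨α, fun hev => ?_⟩
    obtain ⟨N, hN⟩ := eventually_atTop.1 hev
    have hsub : (fun m => (node (branch i m) : TowerSpace u)) ''
        ({m | ∃ n, s n = node (branch i m)} \ u i α) ⊆ s '' Iio N := by
      rintro _ ⟨m, ⟨⟨n, hn⟩, hm⟩, rfl⟩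
      refine ⟨n, ?_, hn⟩
      by_contra hc
      refine hN n (not_lt.1 hc) ?_
      change s n ∈ lower u i α
      rw [hn]
      exact ⟨m, hm, rfl⟩
    exact (hα.image ((node_injective.comp (branch_injective i)).injOn))
      (((finite_Iio N).image s).subset hsub)
  · have hfr : ∃ᶠ n in atTop, ∃ α, s n = limit i α := by
      refine (h.and_eventually (not_frequently.1 hn)).mono ?_
      rintro n ⟨h1, h2⟩
      cases hx : s n with
      | node d =>
        rw [hx] at h1 h2
        obtain ⟨m, rfl⟩ := h1
        exact absurd ⟨m, trivial, rfl⟩ h2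
      | limit j α =>
        rw [hx] at h1
        exact ⟨α, by rw [show j = i from h1]⟩
      | infty =>
        rw [hx] at h1
        exact h1.elim
    obtain ⟨-, α₀, -⟩ := hfr.exists
    classical
    obtain ⟨b, hb⟩ := hbdd fun n => if h : ∃ α, s n = limit i α then h.choose else α₀
    refine ⟨b, hfr.mono fun n hn => ?_⟩
    have := hb n
    rw [dif_pos hn] at this
    rw [show s n = _ from hn.choose_spec]
    exact ⟨rfl, this⟩

lemma seqCompactSpace [WellFoundedLT W]
    (hdec : ∀ i α β, α ≤ β → (u i β \ u i α).Finite)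
    (hbdd : ∀ f : ℕ → W, ∃ b, ∀ n, f n ≤ b)
    (hsplit : ∀ i (B : Set ℕ), B.Infinite → ∃ α, (B \ u i α).Infinite) :
    SeqCompactSpace (TowerSpace u) := by
  refine ⟨fun s _ => ?_⟩
  by_cases hs : Tendsto s atTop cofinite
  · by_cases h : ∃ i, ∃ᶠ n in atTop, s n ∈ strand u i
    · obtain ⟨i, hi⟩ := h
      obtain ⟨α, φ, hφ, hlim⟩ := exists_tendsto_limit_of_lower hdec hs
        (exists_frequently_mem_lower hbdd hsplit hs hi)
      exact ⟨_, mem_univ _, φ, hφ, hlim⟩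
    · simp only [not_exists, not_frequently] at h
      refine ⟨infty, mem_univ _, id, strictMono_id, tendsto_of_isBasic fun S hS => ?_⟩
      cases hS with
      | singleton d =>
        filter_upwards [eventually_notMem hs (finite_singleton (node d))] with n hn
        exact iff_of_false hn (by simp)
      | strand j =>
        filter_upwards [h j] with n hn
        exact iff_of_false hn id
      | lower j β =>
        filter_upwards [h j] with n hn
        exact iff_of_false (fun hc => hn (lower_subset_strand j β hc)) id
  · have : ∃ x, ∃ᶠ n in atTop, s n = x := by
      by_contra! hc
      refine hs (le_cofinite_iff_eventually_ne.2 fun x => ?_)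
      exact eventually_map.2 (hc x)
    obtain ⟨x, hx⟩ := this
    obtain ⟨φ, hφ, hmem⟩ := extraction_of_frequently_atTop hx
    refine ⟨x, mem_univ _, φ, hφ, ?_⟩
    rw [show s ∘ φ = fun _ => x from funext hmem]
    exact tendsto_const_nhds

lemma exists_isOpen_notMem {q : Ultrafilter ℕ} (hq : Nonprincipal q) {i : ℕ → Bool}
    (hu : ∀ α, u i α ∈ q) (y : TowerSpace u) :
    ∃ V, IsOpen V ∧ y ∈ V ∧ {n | (node (branch i n) : TowerSpace u) ∈ V} ∉ q := by
  have hinj : Function.Injective fun n => (node (branch i n) : TowerSpace u) :=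
    node_injective.comp (branch_injective i)
  have hfin : ∀ F : Set (TowerSpace u), F.Finite →
      {n | (node (branch i n) : TowerSpace u) ∈ F} ∉ q :=
    fun F hF => hq _ (hF.preimage hinj.injOn)
  cases y with
  | node d => exact ⟨_, (IsBasic.singleton d).isOpen, rfl, hfin _ (finite_singleton _)⟩
  | infty =>
    refine ⟨_, (IsBasic.strand i).isOpen_compl, id, ?_⟩
    convert q.empty_notMem
    refine eq_empty_of_forall_notMem fun n hn => hn ⟨n, rfl⟩
  | limit j α =>
    by_cases hj : j = i
    · subst hj
      refine ⟨_, (IsBasic.lower j α).isOpen, ⟨rfl, le_rfl⟩, fun hc => ?_⟩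
      refine q.empty_notMem (mem_of_superset (inter_mem hc (hu α)) ?_)
      rintro n ⟨⟨m, hm, hmn⟩, hn⟩
      exact hm (branch_injective j hmn ▸ hn)
    · refine ⟨_, (IsBasic.strand j).isOpen, rfl, fun hc => ?_⟩
      refine hfin _ (finite_strand_inter hj) (mem_of_superset hc ?_)
      exact fun n hn => ⟨hn, n, rfl⟩

end TowerSpace

lemma exists_infinite_diff_of_base {q : Ultrafilter ℕ} {W : Type*} {v : W → Set ℕ}
    (hbase : ∀ A : Set ℕ, A ∈ q → ∃ α, v α ⊆ A) {B : Set ℕ} (hB : B.Infinite) :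
    ∃ α, (B \ v α).Infinite := by
  have key : ∀ C ⊆ B, C.Infinite → C ∉ q → ∃ α, (B \ v α).Infinite := by
    intro C hCB hC hCq
    obtain ⟨α, hα⟩ := hbase _ (Ultrafilter.compl_mem_iff_notMem.2 hCq)
    exact ⟨α, hC.mono fun n hn => ⟨hCB hn, fun hc => hα hc hn⟩⟩
  let e := hB.natEmbedding
  have he : Function.Injective fun k => (e k : ℕ) :=
    Subtype.val_injective.comp e.injective
  let C : Set ℕ := range fun k => (e (2 * k) : ℕ)
  let D : Set ℕ := range fun k => (e (2 * k + 1) : ℕ)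
  have hC : C.Infinite := infinite_range_of_injective
    (he.comp fun a b (h : 2 * a = 2 * b) => by omega)
  have hD : D.Infinite := infinite_range_of_injective
    (he.comp fun a b (h : 2 * a + 1 = 2 * b + 1) => by omega)
  by_cases hCq : C ∈ q
  · refine key D (by rintro _ ⟨k, rfl⟩; exact (e _).2) hD fun hDq => ?_
    refine q.empty_notMem (mem_of_superset (inter_mem hCq hDq) ?_)
    rintro _ ⟨⟨a, rfl⟩, ⟨b, hb⟩⟩
    have := he hb
    omega
  · exact key C (by rintro _ ⟨k, rfl⟩; exact (e _).2) hC hCq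

/-- The first uncountable ordinal as a type in the lowest universe. -/
abbrev OmegaOne : Type := (Cardinal.aleph.{0} 1).ord.ToType

lemma OmegaOne.exists_forall_le (f : ℕ → OmegaOne) : ∃ b, ∀ n, f n ≤ b := by
  have hlt : ∀ n, ((f n).toOrd : Ordinal) < Ordinal.omega 1 := fun n => by
    have := (f n).toOrd.2
    exact (mem_Iio.1 this).trans_eq (Cardinal.ord_aleph 1)
  have hsup := Ordinal.iSup_lt_omega_one hlt
  rw [← Cardinal.ord_aleph] at hsup
  refine ⟨Ordinal.ToType.mk ⟨_, hsup⟩, fun n => ?_⟩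
  rw [← OrderIso.symm_apply_le]
  exact Ordinal.le_iSup (fun n => ((f n).toOrd : Ordinal)) n

lemma HasTowerBase.exists_omegaOne {q : Ultrafilter ℕ} (hq : HasTowerBase q) :
    ∃ v : OmegaOne → Set ℕ, (∀ α β, α ≤ β → (v β \ v α).Finite) ∧
      ∀ A : Set ℕ, A ∈ q ↔ ∃ α, v α ⊆ A := by
  obtain ⟨u, -, hdec, hbase⟩ := hq
  refine ⟨fun α => u ⟨α.toOrd.1, α.toOrd.2⟩, fun α β h => ?_, fun A => ?_⟩
  · rcases h.eq_or_lt with rfl | h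
    · simp
    · exact hdec _ _ (Ordinal.ToType.mk.symm.lt_iff_lt.2 h)
  · rw [hbase]
    constructor
    · rintro ⟨α, hα⟩
      refine ⟨Ordinal.ToType.mk ⟨α.1, α.2⟩, ?_⟩
      simpa using hα
    · rintro ⟨α, hα⟩
      exact ⟨_, hα⟩

/-- Under the stated NCF-type hypothesis (true in the Miller model), there is a
separable, sequentially compact Hausdorff space of cardinality `𝔠` that is not
`p`-compact for any nonprincipal ultrafilter `p`. -/
theorem statement4 (P : Set (Ultrafilter ℕ))
    (hsmall : Cardinal.mk P ≤ Cardinal.continuum)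
    (hP : ∀ q ∈ P, Nonprincipal q ∧ IsPPoint q ∧ HasTowerBase q)
    (hcof : ∀ u : Ultrafilter ℕ, Nonprincipal u →
      ∃ f : ℕ → ℕ, FiniteToOne f ∧ ∃ q ∈ P, Ultrafilter.map f u = q) :
    ∃ (X : Type) (t : TopologicalSpace X),
      @T2Space X t ∧ @TopologicalSpace.SeparableSpace X t ∧ @SeqCompactSpace X t ∧
      Cardinal.mk X = Cardinal.continuum ∧
      ∀ p : Ultrafilter ℕ, Nonprincipal p → ¬ @PCompact X t p := by
  have hne : Nonempty P := by
    obtain ⟨-, -, q, hq, -⟩ := hcof (hyperfilter ℕ) fun A hA => notMem_hyperfilter_of_finite hA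
    exact ⟨q, hq⟩
  have hle : Cardinal.mk P ≤ Cardinal.mk (ℕ → Bool) := by simpa using hsmall
  obtain ⟨e⟩ := hle
  have hg := Function.invFun_surjective e.injective
  set g : (ℕ → Bool) → P := Function.invFun e
  have hbase := fun i => (hP (g i) (g i).2).2.2.exists_omegaOne
  choose u hdec hmem using hbase
  have hsplit : ∀ i (B : Set ℕ), B.Infinite → ∃ α, (B \ u i α).Infinite :=
    fun i B hB => exists_infinite_diff_of_base (fun A => (hmem i A).1) hB
  have hX : SeqCompactSpace (TowerSpace u) :=
    TowerSpace.seqCompactSpace hdec OmegaOne.exists_forall_le hsplit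
  let N : Set (TowerSpace u) := range TowerSpace.node
  have hNsub : N ⊆ closure N := subset_closure
  refine ⟨closure N, inferInstance, inferInstance, ?_, ?_, ?_, ?_⟩
  · have hd : DenseRange (inclusion hNsub) := (denseRange_inclusion_iff hNsub).2 subset_rfl
    have : Countable N := (countable_range _).to_subtype
    exact ⟨range (inclusion hNsub), countable_range _, hd⟩
  · rw [← isSeqCompact_iff_seqCompactSpace]
    intro s hs
    obtain ⟨y, -, φ, hφ, hlim⟩ := hX.isSeqCompact_univ fun n => mem_univ (s n)
    exact ⟨y, isClosed_closure.mem_of_tendsto hlim (Eventually.of_forall fun n => hs _),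
      φ, hφ, hlim⟩
  · refine le_antisymm ((Cardinal.mk_subtype_le _).trans (TowerSpace.mk_le_continuum ?_)) ?_
    · rw [Cardinal.mk_toType, Cardinal.card_ord]
      exact Cardinal.aleph_one_le_continuum
    · have hlim : ∀ i, ∃ α, TowerSpace.limit i α ∈ closure N := by
        intro i
        have hs : Tendsto (fun n => (TowerSpace.node (branch i n) : TowerSpace u))
            atTop cofinite := by
          rw [← Nat.cofinite_eq_atTop]
          exact (TowerSpace.node_injective.comp (branch_injective i)).tendsto_cofinite
        obtain ⟨α, φ, -, h⟩ := TowerSpace.exists_tendsto_limit_of_lower hdec hs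
          (TowerSpace.exists_frequently_mem_lower OmegaOne.exists_forall_le hsplit hs
            (i := i) (Eventually.of_forall fun n => ⟨n, rfl⟩).frequently)
        exact ⟨α, mem_closure_of_tendsto h (Eventually.of_forall fun n => ⟨_, rfl⟩)⟩
      choose α hα using hlim
      have hinj : Function.Injective fun i => (⟨_, hα i⟩ : closure N) := by
        intro i j h
        exact (TowerSpace.limit.inj (congrArg Subtype.val h)).1
      simpa using Cardinal.mk_le_of_injective hinj
  · intro p hp hcomp
    obtain ⟨f, -, q, hq, hfq⟩ := hcof p hp
    obtain ⟨i, hi⟩ := hg ⟨q, hq⟩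
    have hui : ∀ α, u i α ∈ q := fun α => by
      have := (hmem i (u i α)).2 ⟨α, subset_rfl⟩
      rwa [hi] at this
    obtain ⟨y, hy⟩ := hcomp fun n =>
      ⟨TowerSpace.node (branch i (f n)), hNsub ⟨_, rfl⟩⟩
    obtain ⟨V, hV, hyV, hn⟩ := TowerSpace.exists_isOpen_notMem (hP q hq).1 hui y.1
    refine hn ?_
    rw [← hfq, Ultrafilter.mem_map]
    exact hy (Subtype.val ⁻¹' V) (hV.preimage continuous_subtype_val) hyV
end

section
/- Let p be a nonprincipal ultrafilter on ℕ having a filter base that is a ⊆*-decreasing ω₁-sequence (u_α)_{α<ω₁} of infinite subsets of ℕ with u_α \ u_{α+1} infinite for every α < ω₁. Then there exists a Hausdorff topological space Y that is separable, sequentially compact, of cardinality ℵ₁, and not p-compact. -/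
open Filter Topology Set

section Franklin

variable {K : Type}

/-- The underlying set `ℕ ⊔ K` of the Franklin space of a family `F : K → Set ℕ`. -/
def FranklinSpace (_F : K → Set ℕ) : Type := ℕ ⊕ K

namespace FranklinSpace

variable {F : K → Set ℕ}

/-- The points of `ℕ` in the Franklin space; they are isolated. -/
def nat (F : K → Set ℕ) (n : ℕ) : FranklinSpace F := Sum.inl n

/-- The points of the index set `K` in the Franklin space. -/
def idx (F : K → Set ℕ) (α : K) : FranklinSpace F := Sum.inr α

theorem nat_idx_cases {P : FranklinSpace F → Prop} (hn : ∀ n, P (nat F n)) (hi : ∀ α, P (idx F α))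
    (x : FranklinSpace F) : P x :=
  Sum.rec hn hi x

theorem idx_ne_nat (α : K) (n : ℕ) : idx F α ≠ nat F n := Sum.inr_ne_inl

theorem nat_injective : Function.Injective (nat F) := Sum.inl_injective

theorem idx_injective : Function.Injective (idx F) := Sum.inr_injective

variable [LinearOrder K]

/-- A set `U` contains the Franklin neighbourhood of `α` determined by `β < α` up to finitely many
points of `ℕ`. -/
def ContainsTail (F : K → Set ℕ) (U : Set (FranklinSpace F)) (α β : K) : Prop :=
  (∀ γ, β < γ → γ ≤ α → idx F γ ∈ U) ∧ {n | n ∈ F α ∧ n ∉ F β ∧ nat F n ∉ U}.Finite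

/-- The Franklin topology of a `⊆*`-increasing family `F`. -/
@[reducible]
def topology (hF : ∀ α β, α < β → AlmostSubset (F α) (F β)) :
    TopologicalSpace (FranklinSpace F) where
  IsOpen U := ∀ α, idx F α ∈ U → ¬ IsMin α → ∃ β < α, ContainsTail F U α β
  isOpen_univ α _ hα := by
    obtain ⟨β, hβ⟩ := not_isMin_iff.1 hα
    exact ⟨β, hβ, by simp [ContainsTail]⟩
  isOpen_inter U V hU hV α hα hmin := by
    have weaken : ∀ {W : Set (FranklinSpace F)} {β δ : K}, β ≤ δ →
        ContainsTail F W α β → ContainsTail F W α δ := by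
      intro W β δ hβδ h
      refine ⟨fun γ h₁ h₂ => h.1 γ (hβδ.trans_lt h₁) h₂, ?_⟩
      rcases hβδ.eq_or_lt with rfl | hlt
      · exact h.2
      · refine (h.2.union (hF β δ hlt)).subset ?_
        rintro n ⟨h₁, h₂, h₃⟩
        by_cases hn : n ∈ F β
        · exact Or.inr ⟨hn, h₂⟩
        · exact Or.inl ⟨h₁, hn, h₃⟩
    obtain ⟨β, hβ, h₁⟩ := hU α hα.1 hmin
    obtain ⟨δ, hδ, h₂⟩ := hV α hα.2 hmin
    replace h₁ := weaken (le_max_left β δ) h₁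
    replace h₂ := weaken (le_max_right β δ) h₂
    refine ⟨max β δ, max_lt hβ hδ, fun γ hγ hγ' => ⟨h₁.1 γ hγ hγ', h₂.1 γ hγ hγ'⟩,
      (h₁.2.union h₂.2).subset ?_⟩
    rintro n ⟨a, b, c⟩
    by_cases hn : nat F n ∈ U
    · exact Or.inr ⟨a, b, fun hV => c ⟨hn, hV⟩⟩
    · exact Or.inl ⟨a, b, hn⟩
  isOpen_sUnion S hS α hα hmin := by
    obtain ⟨U, hU, hαU⟩ := hα
    obtain ⟨β, hβ, h⟩ := hS U hU α hαU hmin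
    refine ⟨β, hβ, fun γ h₁ h₂ => ⟨U, hU, h.1 γ h₁ h₂⟩, h.2.subset ?_⟩
    rintro n ⟨a, b, c⟩
    exact ⟨a, b, fun hn => c ⟨U, hU, hn⟩⟩

variable (hF : ∀ α β, α < β → AlmostSubset (F α) (F β))

theorem isOpen_iff {U : Set (FranklinSpace F)} :
    IsOpen[topology hF] U ↔ ∀ α, idx F α ∈ U → ¬ IsMin α → ∃ β < α, ContainsTail F U α β :=
  Iff.rfl

theorem isOpen_singleton_nat (n : ℕ) : IsOpen[topology hF] {nat F n} :=
  fun α hα _ => absurd hα (idx_ne_nat α n)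

theorem isOpen_compl_singleton_nat (n : ℕ) : IsOpen[topology hF] {nat F n}ᶜ := by
  intro α _ hmin
  obtain ⟨β, hβ⟩ := not_isMin_iff.1 hmin
  refine ⟨β, hβ, fun γ _ _ => idx_ne_nat γ n, (finite_singleton n).subset ?_⟩
  rintro m ⟨-, -, h⟩
  exact nat_injective (not_not.1 h)

/-- The initial segment of the Franklin space up to `α`. -/
def lower (F : K → Set ℕ) (α : K) : Set (FranklinSpace F) :=
  idx F '' Iic α ∪ nat F '' F α

@[simp]
theorem nat_mem_lower {α : K} {n : ℕ} : nat F n ∈ lower F α ↔ n ∈ F α := by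
  simp [lower, nat_injective.eq_iff, idx_ne_nat]

@[simp]
theorem idx_mem_lower {α γ : K} : idx F γ ∈ lower F α ↔ γ ≤ α := by
  simp [lower, idx_injective.eq_iff, (idx_ne_nat _ _).symm]

theorem isOpen_lower (α : K) : IsOpen[topology hF] (lower F α) := by
  intro γ hγ hmin
  rw [idx_mem_lower] at hγ
  obtain ⟨β, hβ⟩ := not_isMin_iff.1 hmin
  refine ⟨β, hβ, fun δ _ hδ => idx_mem_lower.2 (hδ.trans hγ), ?_⟩
  simp only [nat_mem_lower]
  rcases hγ.eq_or_lt with rfl | hlt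
  · convert! finite_empty using 1
    ext n
    simp
  · exact (hF γ α hlt).subset fun n hn => ⟨hn.1, hn.2.2⟩

theorem isOpen_compl_lower (α : K) : IsOpen[topology hF] (lower F α)ᶜ := by
  intro γ hγ _
  rw [mem_compl_iff, idx_mem_lower, not_le] at hγ
  refine ⟨α, hγ, fun δ hδ _ => by simpa using hδ, ?_⟩
  convert! finite_empty using 1
  ext n
  simp

theorem t2Space : @T2Space _ (topology hF) := by
  let := topology hF
  have sep : ∀ {x y : FranklinSpace F} (U : Set (FranklinSpace F)), IsOpen U → IsOpen Uᶜ →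
      x ∈ U → y ∉ U → ∃ u v : Set (FranklinSpace F),
        IsOpen u ∧ IsOpen v ∧ x ∈ u ∧ y ∈ v ∧ Disjoint u v :=
    fun U hU hU' hx hy => ⟨U, Uᶜ, hU, hU', hx, hy, disjoint_compl_right⟩
  have sep' : ∀ {x y : FranklinSpace F} (U : Set (FranklinSpace F)), IsOpen U → IsOpen Uᶜ →
      y ∈ U → x ∉ U → ∃ u v : Set (FranklinSpace F),
        IsOpen u ∧ IsOpen v ∧ x ∈ u ∧ y ∈ v ∧ Disjoint u v :=
    fun U hU hU' hy hx => ⟨Uᶜ, U, hU', hU, hx, hy, disjoint_compl_left⟩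
  refine ⟨fun x y hxy => ?_⟩
  induction x using nat_idx_cases with
  | hn n =>
    exact sep {nat F n} (isOpen_singleton_nat hF n) (isOpen_compl_singleton_nat hF n) rfl hxy.symm
  | hi α =>
    induction y using nat_idx_cases with
    | hn n =>
      exact sep' {nat F n} (isOpen_singleton_nat hF n) (isOpen_compl_singleton_nat hF n) rfl hxy
    | hi γ =>
      rcases lt_or_gt_of_ne (fun h : α = γ => hxy (congrArg _ h)) with h | h
      · exact sep (lower F α) (isOpen_lower hF α) (isOpen_compl_lower hF α) (by simp) (by simpa)
      · exact sep' (lower F γ) (isOpen_lower hF γ) (isOpen_compl_lower hF γ) (by simp) (by simpa)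

theorem separableSpace (hgap : ∀ α β, α < β → (F β \ F α).Infinite) :
    @TopologicalSpace.SeparableSpace _ (topology hF) := by
  let := topology hF
  refine ⟨range (nat F) ∪ idx F '' {α | IsMin α}, ?_, ?_⟩
  · refine (countable_range _).union (Set.Subsingleton.countable ?_)
    rintro _ ⟨α, hα, rfl⟩ _ ⟨β, hβ, rfl⟩
    rcases le_total α β with h | h
    · rw [h.antisymm (hβ h)]
    · rw [h.antisymm (hα h)]
  · intro x
    induction x using nat_idx_cases with
    | hn n => exact subset_closure (Or.inl ⟨n, rfl⟩)
    | hi α =>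
      by_cases hmin : IsMin α
      · exact subset_closure (Or.inr ⟨α, hmin, rfl⟩)
      · rw [mem_closure_iff]
        intro U hU hα
        obtain ⟨β, hβ, -, hfin⟩ := (isOpen_iff hF).1 hU α hα hmin
        obtain ⟨n, hn, hn'⟩ := ((hgap β α hβ).sdiff hfin).nonempty
        refine ⟨nat F n, ?_, Or.inl ⟨n, rfl⟩⟩
        by_contra hU
        exact hn' ⟨hn.1, hn.2, hU⟩

theorem exists_tendsto_subseq_idx [WellFoundedLT K]
    (hbdd : ∀ f : ℕ → K, BddAbove (range f)) (f : ℕ → K) :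
    ∃ a : FranklinSpace F, ∃ φ : ℕ → ℕ, StrictMono φ ∧
      Tendsto (fun k => idx F (f (φ k))) atTop (@nhds _ (topology hF) a) := by
  let := topology hF
  obtain ⟨g, hg⟩ : ∃ g : ℕ ↪o ℕ, Monotone (f ∘ g) := by
    obtain ⟨g, h | h⟩ := exists_increasing_or_nonincreasing_subseq (α := K) (· ≤ ·) f
    · exact ⟨g, fun m n hmn => hmn.eq_or_lt.elim (fun e => e ▸ le_rfl) (h m n)⟩
    · refine absurd ?_ (not_strictAnti_of_wellFoundedLT (f ∘ g))
      exact fun m n hmn => not_le.1 (h m n hmn)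
  obtain ⟨α, hα, hmin⟩ := WellFounded.has_min (wellFounded_lt (α := K))
    (upperBounds (range (f ∘ g))) (hbdd _)
  refine ⟨idx F α, g, g.strictMono, tendsto_nhds.2 fun U hU hαU => ?_⟩
  have hle : ∀ k, f (g k) ≤ α := fun k => hα ⟨k, rfl⟩
  by_cases hm : IsMin α
  · refine Eventually.of_forall fun k => ?_
    have heq : f (g k) = α := (hle k).antisymm (hm (hle k))
    simpa only [heq]
  · obtain ⟨β, hβ, h, -⟩ := (isOpen_iff hF).1 hU α hαU hm
    have : β ∉ upperBounds (range (f ∘ g)) := fun hu => hmin β hu hβ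
    obtain ⟨k, hk⟩ : ∃ k, β < f (g k) := by
      by_contra! hcon
      exact this (by rintro _ ⟨k, rfl⟩; exact hcon k)
    filter_upwards [eventually_ge_atTop k] with m hkm
    exact h _ (hk.trans_le (hg hkm)) (hle m)

theorem exists_tendsto_subseq_nat_of_injective [WellFoundedLT K]
    (hbot : ∀ α, IsMin α → (F α).Finite) {h : ℕ → ℕ} (hinj : Function.Injective h)
    {δ : K} (hδ : ∀ k, h k ∈ F δ) :
    ∃ a : FranklinSpace F, ∃ φ : ℕ → ℕ, StrictMono φ ∧
      Tendsto (fun k => nat F (h (φ k))) atTop (@nhds _ (topology hF) a) := by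
  let := topology hF
  obtain ⟨α, hα, hmin⟩ := WellFounded.has_min (wellFounded_lt (α := K))
    {α | (h ⁻¹' F α).Infinite} ⟨δ, by
      have : h ⁻¹' F δ = univ := eq_univ_of_forall hδ
      simp [this, infinite_univ]⟩
  obtain ⟨φ, hφ, hφα⟩ := extraction_of_frequently_atTop
    (Nat.frequently_atTop_iff_infinite.2 (show (h ⁻¹' F α).Infinite from hα))
  refine ⟨idx F α, φ, hφ, tendsto_nhds.2 fun U hU hαU => ?_⟩
  have hm : ¬ IsMin α := fun hm => hα ((hbot α hm).preimage hinj.injOn)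
  obtain ⟨β, hβ, -, hfin⟩ := (isOpen_iff hF).1 hU α hαU hm
  have hβfin : (h ⁻¹' F β).Finite := not_infinite.1 fun hinf => hmin β hinf hβ
  have hbad := (hβfin.union (hfin.preimage hinj.injOn)).preimage hφ.injective.injOn
  have := hbad.compl_mem_cofinite
  rw [Nat.cofinite_eq_atTop] at this
  filter_upwards [this] with k hk
  by_contra hkU
  refine hk ?_
  by_cases hkβ : h (φ k) ∈ F β
  · exact Or.inl hkβ
  · exact Or.inr ⟨hφα k, hkβ, hkU⟩

theorem exists_tendsto_subseq_nat [WellFoundedLT K] (p : Ultrafilter ℕ)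
    (hbot : ∀ α, IsMin α → (F α).Finite) (hcov : ∀ A, A ∉ p → ∃ α, A ⊆ F α) (g : ℕ → ℕ) :
    ∃ a : FranklinSpace F, ∃ φ : ℕ → ℕ, StrictMono φ ∧
      Tendsto (fun k => nat F (g (φ k))) atTop (@nhds _ (topology hF) a) := by
  let := topology hF
  by_cases hg : Tendsto g atTop atTop
  · obtain ⟨φ, hφ, hgφ⟩ := strictMono_subseq_of_tendsto_atTop hg
    obtain ⟨ψ, hψ, hp⟩ : ∃ ψ : ℕ → ℕ, StrictMono ψ ∧ range (g ∘ φ ∘ ψ) ∉ p := by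
      by_cases hp : range (g ∘ φ ∘ fun k => 2 * k) ∈ p
      · refine ⟨fun k => 2 * k + 1, fun a b hab => by simpa using hab, fun hp' => ?_⟩
        obtain ⟨-, ⟨a, rfl⟩, b, hb⟩ := p.nonempty_of_mem (inter_mem hp hp')
        have : 2 * b + 1 = 2 * a := hgφ.injective hb
        omega
      · exact ⟨fun k => 2 * k, fun a b hab => by simpa using hab, hp⟩
    obtain ⟨δ, hδ⟩ := hcov _ hp
    obtain ⟨a, χ, hχ, ha⟩ := exists_tendsto_subseq_nat_of_injective hF hbot
      (hgφ.comp hψ).injective (fun k => hδ ⟨k, rfl⟩)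
    exact ⟨a, φ ∘ ψ ∘ χ, hφ.comp (hψ.comp hχ), ha⟩
  · obtain ⟨n, hn⟩ : ∃ n, ∃ᶠ k in atTop, g k = n := by
      by_contra! hcon
      refine hg ?_
      rw [← Nat.cofinite_eq_atTop]
      refine Tendsto.cofinite_of_finite_preimage_singleton fun n => ?_
      refine not_infinite.1 fun hinf => ?_
      exact Nat.frequently_atTop_iff_infinite.2 hinf (hcon n)
    obtain ⟨φ, hφ, h⟩ := extraction_of_frequently_atTop hn
    refine ⟨nat F n, φ, hφ, ?_⟩
    simp only [h]
    exact tendsto_const_nhds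

theorem seqCompactSpace [WellFoundedLT K] (p : Ultrafilter ℕ)
    (hbdd : ∀ f : ℕ → K, BddAbove (range f))
    (hbot : ∀ α, IsMin α → (F α).Finite) (hcov : ∀ A, A ∉ p → ∃ α, A ⊆ F α) :
    @SeqCompactSpace _ (topology hF) := by
  let := topology hF
  refine ⟨fun x _ => ?_⟩
  suffices ∃ a : FranklinSpace F, ∃ φ : ℕ → ℕ, StrictMono φ ∧ Tendsto (x ∘ φ) atTop (𝓝 a) by
    simpa using this
  by_cases h : ∃ᶠ k in atTop, ∃ n, x k = nat F n
  · obtain ⟨φ, hφ, hx⟩ := extraction_of_frequently_atTop h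
    choose g hg using hx
    obtain ⟨a, ψ, hψ, ha⟩ := exists_tendsto_subseq_nat hF p hbot hcov g
    exact ⟨a, φ ∘ ψ, hφ.comp hψ, ha.congr fun k => (hg _).symm⟩
  · have h' : ∃ᶠ k in atTop, ∃ α, x k = idx F α := by
      refine (not_frequently.1 h).frequently.mono fun k hk => ?_
      generalize x k = y at hk
      induction y using nat_idx_cases with
      | hn n => exact absurd ⟨n, rfl⟩ hk
      | hi α => exact ⟨α, rfl⟩
    obtain ⟨φ, hφ, hx⟩ := extraction_of_frequently_atTop h'
    choose f hf using hx
    obtain ⟨a, ψ, hψ, ha⟩ := exists_tendsto_subseq_idx hF hbdd f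
    exact ⟨a, φ ∘ ψ, hφ.comp hψ, ha.congr fun k => (hf _).symm⟩

theorem not_pCompact {p : Ultrafilter ℕ} (hp : Nonprincipal p) (hFp : ∀ α, F α ∉ p) :
    ¬ @PCompact _ (topology hF) p := by
  let := topology hF
  intro h
  obtain ⟨y, hy⟩ := h (nat F)
  induction y using nat_idx_cases with
  | hn n =>
    refine hp {n} (finite_singleton n) ?_
    simpa [nat_injective.eq_iff] using hy _ (isOpen_singleton_nat hF n) rfl
  | hi α =>
    exact hFp α (by simpa using hy _ (isOpen_lower hF α) (by simp))

end FranklinSpace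

end Franklin

/-- In a `⊆*`-decreasing tower with infinite successor differences, all differences are infinite. -/
theorem infinite_sdiff_of_lt {o : Ordinal.{0}} {u : {a : Ordinal.{0} // a < o} → Set ℕ}
    (hdec : ∀ α β, α.1 < β.1 → AlmostSubset (u β) (u α))
    (hsucc : ∀ α β, β.1 = α.1 + 1 → (u α \ u β).Infinite)
    {α β : {a : Ordinal.{0} // a < o}} (h : α < β) : (u α \ u β).Infinite := by
  have hle : α.1 + 1 ≤ β.1 := Order.add_one_le_of_lt h
  let γ : {a : Ordinal.{0} // a < o} := ⟨α.1 + 1, hle.trans_lt β.2⟩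
  have hγβ : (u β \ u γ).Finite := by
    rcases hle.eq_or_lt with heq | hlt
    · have : γ = β := Subtype.ext heq
      simp [this]
    · exact hdec γ β hlt
  refine fun hfin => hsucc α γ rfl ((hfin.union hγβ).subset fun n hn => ?_)
  by_cases hn' : n ∈ u β
  · exact Or.inr ⟨hn', hn.2⟩
  · exact Or.inl ⟨hn.1, hn'⟩

theorem bddAbove_range_toType_ord_aleph_one (f : ℕ → (Cardinal.aleph.{0} 1).ord.ToType) :
    BddAbove (range f) := by
  have hlt : ⨆ k, (f k).toOrd.1 < (Cardinal.aleph.{0} 1).ord := by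
    refine (Ordinal.iSup_lt_omega_one fun k => ?_).trans_eq (Cardinal.ord_aleph 1).symm
    exact (f k).toOrd.2.trans_eq (Cardinal.ord_aleph 1)
  refine ⟨Ordinal.ToType.mk ⟨_, hlt⟩, ?_⟩
  rintro _ ⟨k, rfl⟩
  rw [← OrderIso.symm_apply_le]
  exact Ordinal.le_iSup (fun k => (f k).toOrd.1) k

/-- If the nonprincipal ultrafilter `p` has a filter base which is a
`⊆*`-decreasing `ω₁`-tower `(u α)` with each `u α \ u (α+1)` infinite, then there
is a separable, sequentially compact Hausdorff space of cardinality `ℵ₁` that is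
not `p`-compact (the Franklin space of the tower). -/
theorem statement5 (p : Ultrafilter ℕ) (hp : Nonprincipal p)
    (u : {o : Ordinal.{0} // o < (Cardinal.aleph.{0} 1).ord} → Set ℕ)
    (hinf : ∀ α, (u α).Infinite)
    (hdec : ∀ α β, α.1 < β.1 → AlmostSubset (u β) (u α))
    (hbase : ∀ A : Set ℕ, A ∈ p ↔ ∃ α, u α ⊆ A)
    (hsucc : ∀ α β, β.1 = α.1 + 1 → (u α \ u β).Infinite) :
    ∃ (Y : Type) (t : TopologicalSpace Y),
      @T2Space Y t ∧ @TopologicalSpace.SeparableSpace Y t ∧ @SeqCompactSpace Y t ∧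
      Cardinal.mk Y = Cardinal.aleph 1 ∧ ¬ @PCompact Y t p := by
  classical
  let K := (Cardinal.aleph.{0} 1).ord.ToType
  let e : K ≃o {o : Ordinal.{0} // o < (Cardinal.aleph.{0} 1).ord} := Ordinal.ToType.mk.symm
  let F : K → Set ℕ := fun k => if IsMin k then ∅ else (u (e k))ᶜ
  have hFmin : ∀ k, IsMin k → F k = ∅ := fun k hk => if_pos hk
  have hFsucc : ∀ k, ¬ IsMin k → F k = (u (e k))ᶜ := fun k hk => if_neg hk
  have hFsub : ∀ k, F k ⊆ (u (e k))ᶜ := fun k => by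
    by_cases hk : IsMin k
    · simp [hFmin k hk]
    · rw [hFsucc k hk]
  have hgap : ∀ α β, α < β → (F β \ F α).Infinite := fun α β h => by
    refine (infinite_sdiff_of_lt hdec hsucc (e.lt_iff_lt.2 h)).mono fun n hn => ?_
    rw [hFsucc β (not_isMin_of_lt h)]
    exact ⟨hn.2, fun hn' => hFsub α hn' hn.1⟩
  have hF : ∀ α β, α < β → AlmostSubset (F α) (F β) := fun α β h => by
    refine (hdec (e α) (e β) (e.lt_iff_lt.2 h)).subset fun n hn => ?_
    rw [hFsucc β (not_isMin_of_lt h)] at hn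
    exact ⟨not_not.1 hn.2, hFsub α hn.1⟩
  have hFp : ∀ α, F α ∉ p := fun α hα =>
    Ultrafilter.compl_notMem_iff.2 ((hbase _).2 ⟨e α, subset_rfl⟩) (mem_of_superset hα (hFsub α))
  have hcov : ∀ A, A ∉ p → ∃ α, A ⊆ F α := fun A hA => by
    have one_lt : 1 < (Cardinal.aleph.{0} 1).ord := by
      rw [Cardinal.ord_aleph]
      exact Ordinal.one_lt_omega0.trans Ordinal.omega0_lt_omega_one
    let γ : {o : Ordinal.{0} // o < (Cardinal.aleph.{0} 1).ord} := ⟨1, one_lt⟩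
    let ζ : {o : Ordinal.{0} // o < (Cardinal.aleph.{0} 1).ord} := ⟨0, zero_lt_one.trans one_lt⟩
    have hζγ : ζ < γ := Subtype.mk_lt_mk.2 zero_lt_one
    obtain ⟨β, hβ⟩ := (hbase (u γ ∩ Aᶜ)).1
      (inter_mem ((hbase _).2 ⟨γ, subset_rfl⟩) (Ultrafilter.compl_mem_iff_notMem.2 hA))
    refine ⟨e.symm β, ?_⟩
    have hmin : ¬ IsMin (e.symm β) := fun hm => by
      have hle : β ≤ ζ := e.symm.le_iff_le.1 (hm.isBot _)
      obtain ⟨n, hn, hn'⟩ := (infinite_sdiff_of_lt hdec hsucc (hle.trans_lt hζγ)).nonempty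
      exact hn' (hβ hn).1
    rw [hFsucc _ hmin, e.apply_symm_apply]
    exact fun n hn hn' => (hβ hn').2 hn
  refine ⟨FranklinSpace F, FranklinSpace.topology hF, FranklinSpace.t2Space hF,
    FranklinSpace.separableSpace hF hgap,
    FranklinSpace.seqCompactSpace hF p bddAbove_range_toType_ord_aleph_one
      (fun α hα => by simp [hFmin α hα]) hcov, ?_, FranklinSpace.not_pCompact hF hp hFp⟩
  change Cardinal.mk (ℕ ⊕ K) = _
  simpa [K] using Cardinal.add_eq_right (Cardinal.aleph0_le_aleph 1) (Cardinal.aleph0_le_aleph 1)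
end

section
/- Let p be an ultrafilter on ℕ and let (X_i)_{i ∈ ι} be a family of topological spaces each of which is p-compact. Then the product Π_{i ∈ ι} X_i with the product topology is p-compact. -/
theorem isPLimit_iff_tendsto {X : Type*} [TopologicalSpace X] {p : Ultrafilter ℕ} {x : ℕ → X}
    {y : X} : IsPLimit p x y ↔ Filter.Tendsto x p (nhds y) := by
  rw [tendsto_nhds]
  rfl

/-- A product of `p`-compact spaces is `p`-compact. -/
theorem statement6 {ι : Type*} (p : Ultrafilter ℕ) (X : ι → Type*)
    [∀ i, TopologicalSpace (X i)] (h : ∀ i, PCompact (X i) p) :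
    PCompact (∀ i, X i) p := by
  intro x
  choose y hy using fun i => h i fun n => x n i
  exact ⟨y, isPLimit_iff_tendsto.2 <| tendsto_pi_nhds.2 fun i => isPLimit_iff_tendsto.1 (hy i)⟩
end

section
/- For each nonprincipal ultrafilter p on ℕ let X_p be a topological space that is not p-compact, i.e. admits a sequence with no p-limit. Then the product Π_p X_p, taken over all nonprincipal ultrafilters p on ℕ with the product topology, is not countably compact. -/
open Filter Topology in
/-- In a countably compact space every sequence has a cluster point. -/
theorem CountablyCompact.exists_mapClusterPt {X : Type*} [TopologicalSpace X]
    (hX : CountablyCompact X) (z : ℕ → X) : ∃ y, MapClusterPt y atTop z := by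
  by_contra! hz
  let U : ℕ → Set X := fun m => (closure (z '' Set.Ici m))ᶜ
  have hcover : ⋃₀ Set.range U = Set.univ := by
    refine Set.eq_univ_of_forall fun y => ?_
    have hy := hz y
    rw [mapClusterPt_iff_frequently] at hy
    push Not at hy
    obtain ⟨s, hs, hev⟩ := hy
    obtain ⟨m, hm⟩ := eventually_atTop.1 hev
    refine ⟨U m, ⟨m, rfl⟩, fun hcl => ?_⟩
    obtain ⟨_, hws, n, hn, rfl⟩ := mem_closure_iff_nhds.1 hcl s hs
    exact hm n hn hws
  obtain ⟨𝒱, hsub, hfin, hV⟩ := hX (Set.range U) (Set.countable_range U)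
    (by rintro _ ⟨m, rfl⟩; exact isClosed_closure.isOpen_compl) hcover
  have hev : ∀ᶠ n in atTop, ∀ V ∈ 𝒱, z n ∉ V := by
    refine (eventually_all_finite hfin).2 fun V hVmem => ?_
    obtain ⟨m, rfl⟩ := hsub hVmem
    filter_upwards [eventually_ge_atTop m] with n hn hmem
    exact hmem (subset_closure ⟨n, hn, rfl⟩)
  obtain ⟨n, hn⟩ := hev.exists
  obtain ⟨V, hVmem, hnV⟩ := hV.symm ▸ Set.mem_univ (z n)
  exact hn V hVmem hnV

open Filter Topology in
/-- A cluster point of a sequence is a `p`-limit of it for some nonprincipal `p`. -/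
theorem MapClusterPt.exists_isPLimit {X : Type*} [TopologicalSpace X] {z : ℕ → X} {y : X}
    (hy : MapClusterPt y atTop z) :
    ∃ p : Ultrafilter ℕ, Nonprincipal p ∧ IsPLimit p z y := by
  obtain ⟨p, hp, hlim⟩ := mapClusterPt_iff_ultrafilter.1 hy
  refine ⟨p, fun A hA hAp => ?_, fun U hU hyU => hlim (hU.mem_nhds hyU)⟩
  have hcompl : Aᶜ ∈ p := hp (Nat.cofinite_eq_atTop ▸ hA.compl_mem_cofinite)
  exact Ultrafilter.compl_mem_iff_notMem.1 hcompl hAp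

theorem IsPLimit.comp_continuous {X Y : Type*} [TopologicalSpace X] [TopologicalSpace Y]
    {p : Ultrafilter ℕ} {z : ℕ → X} {y : X} (hz : IsPLimit p z y) {f : X → Y}
    (hf : Continuous f) : IsPLimit p (fun n => f (z n)) (f y) :=
  fun U hU hyU => hz (f ⁻¹' U) (hU.preimage hf) hyU

/-- If for each nonprincipal ultrafilter `p` on `ℕ` the space `X p` is not
`p`-compact, then the product of all the `X p` is not countably compact. -/
theorem statement8 (X : {p : Ultrafilter ℕ // Nonprincipal p} → Type*)
    [∀ p, TopologicalSpace (X p)]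
    (h : ∀ p : {p : Ultrafilter ℕ // Nonprincipal p}, ¬ PCompact (X p) p.1) :
    ¬ CountablyCompact (∀ p, X p) := by
  intro hX
  simp only [PCompact, not_forall, not_exists] at h
  choose x hx using h
  obtain ⟨y, hy⟩ := hX.exists_mapClusterPt fun n p => x p n
  obtain ⟨p, hp, hlim⟩ := hy.exists_isPLimit
  exact hx ⟨p, hp⟩ (y ⟨p, hp⟩) (hlim.comp_continuous (continuous_apply ⟨p, hp⟩))
end

section
/- Let X be a topological space that is not p-compact for any nonprincipal ultrafilter p on ℕ. Then the power X^(ℕ → X), i.e. the product of copies of X indexed by the set of all sequences ℕ → X, with the product topology, is not countably compact. -/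
open Filter Topology

theorem CountablyCompact.isCountablyCompact_univ {Y : Type*} [TopologicalSpace Y]
    (hY : CountablyCompact Y) : IsCountablyCompact (Set.univ : Set Y) := by
  rw [isCountablyCompact_iff_countable_open_cover']
  intro U hUo hU
  obtain ⟨𝒱, h𝒱U, h𝒱, hcover⟩ := hY (Set.range U) (Set.countable_range U)
    (Set.forall_mem_range.2 hUo) (Set.univ_subset_iff.1 (Set.sUnion_range U ▸ hU))
  refine ⟨Function.invFun U '' 𝒱, h𝒱.image _, fun y _ => ?_⟩
  obtain ⟨V, hV, hyV⟩ : y ∈ ⋃₀ 𝒱 := hcover ▸ Set.mem_univ y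
  have hUV : U (Function.invFun U V) = V := Function.invFun_eq (h𝒱U hV)
  exact Set.mem_biUnion (Set.mem_image_of_mem _ hV) (hUV.symm ▸ hyV)

theorem nonprincipal_of_le_atTop {p : Ultrafilter ℕ} (hp : (p : Filter ℕ) ≤ atTop) :
    Nonprincipal p := fun _ hA hAp =>
  Ultrafilter.compl_notMem_iff.2 hAp (hp (Nat.cofinite_eq_atTop ▸ hA.compl_mem_cofinite))

theorem IsPLimit.of_tendsto {X : Type*} [TopologicalSpace X] {p : Ultrafilter ℕ} {x : ℕ → X}
    {y : X} (hx : Tendsto x p (𝓝 y)) : IsPLimit p x y :=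
  fun _ hU hy => hx (hU.mem_nhds hy)

/-- If `X` is not `p`-compact for any nonprincipal ultrafilter `p` on `ℕ`, then
the power of `X` indexed by the set of sequences `ℕ → X` is not countably compact. -/
theorem statement9 (X : Type*) [TopologicalSpace X]
    (h : ∀ p : Ultrafilter ℕ, Nonprincipal p → ¬ PCompact X p) :
    ¬ CountablyCompact ((ℕ → X) → X) := by
  intro hc
  obtain ⟨y, -, hy⟩ := isCountablyCompact_iff_seq_clusterPt.1 hc.isCountablyCompact_univ
    (fun n x => x n) (Eventually.of_forall fun _ => Set.mem_univ _)
  obtain ⟨p, hp, hpy⟩ := mapClusterPt_iff_ultrafilter.1 hy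
  exact h p (nonprincipal_of_le_atTop hp) fun x =>
    ⟨y x, .of_tendsto (tendsto_pi_nhds.1 hpy x)⟩
end

section
/- Let ι be a type such that no family of subsets of ℕ indexed by ι is splitting, i.e. for every family s : ι → Set ℕ there is an infinite a ⊆ ℕ such that for every i, a ∩ s i is finite or a \ s i is finite. Then the product space ι → Bool (with Bool discrete and the product topology) is sequentially compact. -/
/-- If no `ι`-indexed family of subsets of `ℕ` is splitting, then the product
space `ι → Bool` is sequentially compact (van Douwen). -/
theorem statement11 (ι : Type*)
    (h : ∀ s : ι → Set ℕ, ∃ a : Set ℕ, a.Infinite ∧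
      ∀ i : ι, (a ∩ s i).Finite ∨ (a \ s i).Finite) :
    SeqCompactSpace (ι → Bool) := by
  refine ⟨fun x _ => ?_⟩
  obtain ⟨a, ha, hs⟩ := h fun i => {n | x n i = true}
  obtain ⟨φ, hφ, hφa⟩ : ∃ φ : ℕ → ℕ, StrictMono φ ∧ ∀ n, φ n ∈ a :=
    ⟨Nat.nth (· ∈ a), Nat.nth_strictMono ha, Nat.nth_mem_of_infinite ha⟩
  have avoid {t : Set ℕ} (ht : t.Finite) : ∀ᶠ n in Filter.atTop, φ n ∉ t :=
    hφ.injective.nat_tendsto_atTop.eventually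
      (Nat.cofinite_eq_atTop ▸ ht.eventually_cofinite_notMem)
  have hlim : ∀ i, ∃ b, ∀ᶠ n in Filter.atTop, x (φ n) i = b := fun i => by
    rcases hs i with hi | hi
    · refine ⟨false, (avoid hi).mono fun n hn => ?_⟩
      simpa [hφa n] using hn
    · refine ⟨true, (avoid hi).mono fun n hn => ?_⟩
      simpa [hφa n] using hn
  choose b hb using hlim
  exact ⟨b, Set.mem_univ b, φ, hφ, tendsto_pi_nhds.2 fun i =>
    tendsto_const_nhds.congr' ((hb i).mono fun _ hn => hn.symm)⟩
end

section
/- Let ι be a type and s : ι → Set ℕ a splitting family, i.e. for every infinite a ⊆ ℕ there is i with both a ∩ s i and a \ s i infinite. Then the product space ι → Bool (with Bool discrete and the product topology) is not sequentially compact. -/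
open Filter in
/-- An infinite subset of the range of a sequence meets every event that holds eventually. -/
theorem Set.Infinite.exists_mem_of_eventually {α : Type*} {φ : ℕ → α} {b : Set α}
    (hb : b.Infinite) (hsub : b ⊆ Set.range φ) {p : ℕ → Prop} (hp : ∀ᶠ n in atTop, p n) :
    ∃ n, φ n ∈ b ∧ p n := by
  obtain ⟨N, hN⟩ := eventually_atTop.1 hp
  by_contra! hcon
  refine hb (((Set.finite_Iio N).image φ).subset fun m hm => ?_)
  obtain ⟨n, rfl⟩ := hsub hm
  exact ⟨n, lt_of_not_ge fun hn => hcon n hm (hN n hn), rfl⟩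

/-- If `s : ι → Set ℕ` is a splitting family, then the product space `ι → Bool`
is not sequentially compact (van Douwen). -/
theorem statement12 (ι : Type*) (s : ι → Set ℕ)
    (h : ∀ a : Set ℕ, a.Infinite → ∃ i : ι, (a ∩ s i).Infinite ∧ (a \ s i).Infinite) :
    ¬ SeqCompactSpace (ι → Bool) := by
  classical
  intro _
  obtain ⟨y, φ, hφ, hy⟩ :=
    SeqCompactSpace.tendsto_subseq (fun (n : ℕ) (i : ι) => decide (n ∈ s i))
  obtain ⟨i, hin, hout⟩ := h (Set.range φ) (Set.infinite_range_of_injective hφ.injective)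
  have hev : ∀ᶠ n in Filter.atTop, decide (φ n ∈ s i) = y i := by
    have hi := tendsto_pi_nhds.1 hy i
    rw [nhds_discrete, Filter.tendsto_pure] at hi
    exact hi
  obtain ⟨m, hm, hmy⟩ := hin.exists_mem_of_eventually Set.inter_subset_left hev
  obtain ⟨n, hn, hny⟩ := hout.exists_mem_of_eventually Set.sdiff_subset hev
  have hmn := hmy.trans hny.symm
  simp [hm.2, hn.2] at hmn
end

section
/- Assume that no family of subsets of ℕ of cardinality at most ℵ₁ is splitting (i.e. for every family s : ι → Set ℕ indexed by a type ι of cardinality at most ℵ₁ there is an infinite a ⊆ ℕ such that for every i, a ∩ s i is finite or a \ s i is finite), and assume 𝔠 < 2^{ℵ₁}. Then for any type ι of cardinality ℵ₁, the product space ι → Bool (with Bool discrete and the product topology) is a separable, sequentially compact, compact Hausdorff space of cardinality 2^{ℵ₁} > 𝔠. -/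
open Filter Topology Cardinal

/-- In a zero-dimensional compact Hausdorff space, a continuous `Bool`-valued function can be
prescribed arbitrarily at finitely many distinct points. -/
theorem exists_continuousMap_bool_eqOn {X ι : Type*} [TopologicalSpace X] [CompactSpace X]
    [T2Space X] [TotallyDisconnectedSpace X] {e : ι → X} (he : Function.Injective e)
    (I : Finset ι) (x : ι → Bool) : ∃ f : C(X, Bool), ∀ i ∈ I, f (e i) = x i := by
  have hA : IsClosed (e '' {i | i ∈ I ∧ x i = true}) :=
    ((I.finite_toSet.subset fun i hi => hi.1).image e).isClosed
  have hB : IsClosed (e '' {i | i ∈ I ∧ x i = false}) :=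
    ((I.finite_toSet.subset fun i hi => hi.1).image e).isClosed
  have hAB : e '' {i | i ∈ I ∧ x i = true} ⊆ (e '' {i | i ∈ I ∧ x i = false})ᶜ := by
    rintro _ ⟨i, hi, rfl⟩ ⟨j, hj, hij⟩
    obtain rfl := he hij
    simp_all
  obtain ⟨C, hC, hAC, hCB⟩ := exists_clopen_of_closed_subset_open hA hB.isOpen_compl hAB
  refine ⟨⟨C.boolIndicator, (continuous_boolIndicator_iff_isClopen C).2 hC⟩, fun i hi => ?_⟩
  change C.boolIndicator (e i) = x i
  cases hx : x i
  · exact (C.notMem_iff_boolIndicator _).1 fun h => hCB h ⟨i, ⟨hi, hx⟩, rfl⟩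
  · exact (C.mem_iff_boolIndicator _).1 (hAC ⟨i, ⟨hi, hx⟩, rfl⟩)

/-- The case of the Hewitt–Marczewski–Pondiczery theorem for powers of the two-point space. -/
theorem separableSpace_pi_bool_of_mk_le_continuum {ι : Type} (hι : #ι ≤ 𝔠) :
    TopologicalSpace.SeparableSpace (ι → Bool) := by
  obtain ⟨e, he⟩ : ∃ e : ι → (ℕ → Bool), Function.Injective e := by
    have h : #ι ≤ #(ℕ → Bool) := by simpa using hι
    obtain ⟨e⟩ := h
    exact ⟨e, e.injective⟩
  have hcont : Continuous fun (f : C(ℕ → Bool, Bool)) (i : ι) => f (e i) :=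
    continuous_pi fun i => continuous_eval_const (e i)
  refine DenseRange.separableSpace (dense_iff_inter_open.2 ?_) hcont
  rintro U hU ⟨x, hx⟩
  obtain ⟨I, u, hu, hIU⟩ := isOpen_pi_iff.1 hU x hx
  obtain ⟨f, hf⟩ := exists_continuousMap_bool_eqOn he I x
  refine ⟨_, hIU fun i hi => ?_, f, rfl⟩
  simpa [hf i hi] using (hu i hi).2

/-- If no family of subsets of `ℕ` indexed by `ι` is splitting, then `ι → Bool` is sequentially
compact. -/
theorem seqCompactSpace_pi_bool {ι : Type*}
    (h : ∀ s : ι → Set ℕ, ∃ a : Set ℕ, a.Infinite ∧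
      ∀ i : ι, (a ∩ s i).Finite ∨ (a \ s i).Finite) :
    SeqCompactSpace (ι → Bool) := by
  refine ⟨fun u _ => ?_⟩
  obtain ⟨a, ha, hs⟩ := h fun i => {n | u n i = true}
  have hφ : StrictMono (Nat.nth (· ∈ a)) := Nat.nth_strictMono ha
  have hmem : ∀ n, Nat.nth (· ∈ a) n ∈ a := Nat.nth_mem_of_infinite ha
  have hlim : ∀ i, ∃ b : Bool, ∀ᶠ n in atTop, u (Nat.nth (· ∈ a) n) i = b := fun i => by
    have key : ∀ t : Set ℕ, t.Finite → ∀ᶠ n in atTop, Nat.nth (· ∈ a) n ∉ t := fun t ht => by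
      have := hφ.injective.tendsto_cofinite.eventually ht.eventually_cofinite_notMem
      rwa [Nat.cofinite_eq_atTop] at this
    rcases hs i with hi | hi
    · refine ⟨false, (key _ hi).mono fun n hn => ?_⟩
      exact Bool.eq_false_iff.2 fun h => hn ⟨hmem n, h⟩
    · refine ⟨true, (key _ hi).mono fun n hn => ?_⟩
      by_contra h
      exact hn ⟨hmem n, h⟩
  choose x hx using hlim
  exact ⟨x, Set.mem_univ x, _, hφ, tendsto_pi_nhds.2 fun i =>
    tendsto_const_nhds.congr' ((hx i).mono fun n hn => hn.symm)⟩

/-- The inequality `𝔠 < 2 ^ ℵ₁` does not depend on the universe. -/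
theorem continuum_lt_two_power_aleph_one_of_universe.{u, v}
    (h : continuum.{u} < 2 ^ aleph.{u} 1) : continuum.{v} < 2 ^ aleph.{v} 1 := by
  have h' := lift_lt.{u, v}.2 h
  rw [← lift_lt.{v, u}]
  simpa using h'

/-- If `𝔰 > ℵ₁` (no family of size `≤ ℵ₁` is splitting) and `𝔠 < 2 ^ ℵ₁`, then
`2 ^ ω₁` is a separable, sequentially compact, compact Hausdorff space of
cardinality `2 ^ ℵ₁ > 𝔠`. -/
theorem statement13
    (hsplit : ∀ ι : Type, Cardinal.mk ι ≤ Cardinal.aleph 1 →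
      ∀ s : ι → Set ℕ, ∃ a : Set ℕ, a.Infinite ∧
        ∀ i : ι, (a ∩ s i).Finite ∨ (a \ s i).Finite)
    (hc : Cardinal.continuum < 2 ^ Cardinal.aleph 1)
    (ι : Type) (hι : Cardinal.mk ι = Cardinal.aleph 1) :
    TopologicalSpace.SeparableSpace (ι → Bool) ∧ SeqCompactSpace (ι → Bool) ∧
    CompactSpace (ι → Bool) ∧ T2Space (ι → Bool) ∧
    Cardinal.mk (ι → Bool) = 2 ^ Cardinal.aleph 1 ∧
    Cardinal.continuum < 2 ^ Cardinal.aleph 1 := by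
  refine ⟨separableSpace_pi_bool_of_mk_le_continuum (hι ▸ aleph_one_le_continuum),
    seqCompactSpace_pi_bool (hsplit ι hι.le), inferInstance, inferInstance, ?_,
    continuum_lt_two_power_aleph_one_of_universe hc⟩
  simp [hι]
end

section
/- Let X be a sequentially compact topological space and f : ℕ → X any function. Then there exists an infinite maximal almost disjoint family A of infinite subsets of ℕ such that for every a ∈ A the subsequence of f with indices in a converges, i.e. there is y ∈ X such that for every open neighbourhood U of y, all but finitely many n ∈ a satisfy f n ∈ U. -/
/-- In a sequentially compact space, every infinite index set has an infinite subset along which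
the sequence converges. -/
theorem exists_infinite_subset_converges {X : Type*} [TopologicalSpace X] [SeqCompactSpace X]
    (f : ℕ → X) {x : Set ℕ} (hx : x.Infinite) :
    ∃ s ⊆ x, s.Infinite ∧
      ∃ y : X, ∀ U : Set X, IsOpen U → y ∈ U → {n ∈ s | f n ∉ U}.Finite := by
  obtain ⟨y, φ, hφ, hy⟩ := SeqCompactSpace.tendsto_subseq (fun k => f (hx.natEmbedding x k))
  refine ⟨Set.range fun k => (hx.natEmbedding x (φ k) : ℕ), ?_, ?_, y, fun U hU hyU => ?_⟩
  · rintro _ ⟨k, rfl⟩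
    exact (hx.natEmbedding x (φ k)).2
  · exact Set.infinite_range_of_injective
      (Subtype.val_injective.comp ((hx.natEmbedding x).injective.comp hφ.injective))
  · have hfin : {k | f (hx.natEmbedding x (φ k)) ∉ U}.Finite := by
      have := hy.eventually (hU.mem_nhds hyU)
      rw [← Nat.cofinite_eq_atTop] at this
      exact this
    refine (hfin.image fun k => (hx.natEmbedding x (φ k) : ℕ)).subset ?_
    rintro _ ⟨⟨k, rfl⟩, hk⟩
    exact ⟨k, hk, rfl⟩

/-- An infinite set contains infinitely many pairwise disjoint infinite subsets. -/
theorem Set.Infinite.exists_infinite_disjoint_family {s : Set ℕ} (hs : s.Infinite) :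
    ∃ B : Set (Set ℕ), B.Infinite ∧ (∀ b ∈ B, b ⊆ s ∧ b.Infinite) ∧
      ∀ a ∈ B, ∀ b ∈ B, a ≠ b → Disjoint a b := by
  have hinj : Function.Injective fun k => (hs.natEmbedding s k : ℕ) :=
    Subtype.val_injective.comp (hs.natEmbedding s).injective
  have hdisj : ∀ {i j k l}, (hs.natEmbedding s (Nat.pair i k) : ℕ) =
      hs.natEmbedding s (Nat.pair j l) → i = j :=
    fun h => (Nat.pair_eq_pair.1 (hinj h)).1
  refine ⟨Set.range fun i => Set.range fun k => (hs.natEmbedding s (Nat.pair i k) : ℕ),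
    Set.infinite_range_of_injective fun i j hij => ?_, ?_, ?_⟩
  · obtain ⟨l, hl⟩ := (Set.ext_iff.1 hij _).1 ⟨0, rfl⟩
    exact (hdisj hl).symm
  · rintro _ ⟨i, rfl⟩
    refine ⟨?_, Set.infinite_range_of_injective fun k l hkl => (Nat.pair_eq_pair.1 (hinj hkl)).2⟩
    rintro _ ⟨k, rfl⟩
    exact (hs.natEmbedding s _).2
  · rintro _ ⟨i, rfl⟩ _ ⟨j, rfl⟩ hne
    refine Set.disjoint_left.2 ?_
    rintro _ ⟨k, rfl⟩ ⟨l, hl⟩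
    exact hne (by rw [hdisj hl])

/-- If every infinite set has an infinite subset satisfying a hereditary property `P`, then there
is an infinite maximal almost disjoint family whose members all satisfy `P`. -/
theorem exists_infinite_isMadFamily {P : Set ℕ → Prop} (hP : ∀ s t, s ⊆ t → P t → P s)
    (hdense : ∀ x : Set ℕ, x.Infinite → ∃ s ⊆ x, s.Infinite ∧ P s) :
    ∃ A : Set (Set ℕ), A.Infinite ∧ IsMadFamily A ∧ ∀ a ∈ A, P a := by
  obtain ⟨s, -, hs, hPs⟩ := hdense Set.univ Set.infinite_univ
  obtain ⟨B, hB, hBs, hBd⟩ := hs.exists_infinite_disjoint_family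
  obtain ⟨A, hBA, hA⟩ := zorn_subset_nonempty
    {A : Set (Set ℕ) | (∀ a ∈ A, a.Infinite ∧ P a) ∧ A.Pairwise fun a b => (a ∩ b).Finite}
    (fun c hc hchain _ => ⟨⋃₀ c,
      ⟨fun a ⟨C, hC, ha⟩ => (hc hC).1 a ha,
        (Set.pairwise_sUnion hchain.directedOn).2 fun C hC => (hc hC).2⟩,
      fun _ => Set.subset_sUnion_of_mem⟩)
    B ⟨fun b hb => ⟨(hBs b hb).2, hP _ _ (hBs b hb).1 hPs⟩,
      fun a ha b hb hab => by simp [(hBd a ha b hb hab).inter_eq]⟩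
  refine ⟨A, hB.mono hBA, ⟨fun a ha => (hA.prop.1 a ha).1,
    fun a ha b hb hab => hA.prop.2 ha hb hab, fun x hx => ?_⟩, fun a ha => (hA.prop.1 a ha).2⟩
  by_contra! hfin
  obtain ⟨t, htx, ht, hPt⟩ := hdense x hx
  have hins : insert t A ∈ {A : Set (Set ℕ) |
      (∀ a ∈ A, a.Infinite ∧ P a) ∧ A.Pairwise fun a b => (a ∩ b).Finite} := by
    refine ⟨Set.forall_mem_insert.2 ⟨⟨ht, hPt⟩, hA.prop.1⟩, hA.prop.2.insert fun a ha _ => ?_⟩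
    have hta := (hfin a ha).subset (Set.inter_subset_inter_left a htx)
    exact ⟨hta, Set.inter_comm t a ▸ hta⟩
  have htA : t ∈ A := hA.le_of_ge hins (Set.subset_insert t A) (Set.mem_insert t A)
  exact ht ((hfin t htA).subset (Set.subset_inter htx subset_rfl))

/-- For any sequence `f` in a sequentially compact space there is an infinite
maximal almost disjoint family `A` such that the subsequence of `f` indexed by
each `a ∈ A` converges. -/
theorem statement14 (X : Type*) [TopologicalSpace X] [SeqCompactSpace X]
    (f : ℕ → X) :
    ∃ A : Set (Set ℕ), A.Infinite ∧ IsMadFamily A ∧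
      ∀ a ∈ A, ∃ y : X, ∀ U : Set X, IsOpen U → y ∈ U → {n ∈ a | f n ∉ U}.Finite := by
  exact exists_infinite_isMadFamily
    (fun s t hst ⟨y, hy⟩ => ⟨y, fun U hU hyU =>
      (hy U hU hyU).subset fun n hn => ⟨hst hn.1, hn.2⟩⟩)
    fun x hx => exists_infinite_subset_converges f hx
end
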